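/- arXiv:2204.09769 — 2 statements merged into one kernel-verified Lean document; each statement's English description precedes it below -/
import Mathlib

section
/- Let V and W be compact subsets of ℝ² that are closures of bounded simply connected open sets. Let F = (u, v) : V → W where u and v are continuous on V, continuously differentiable on the interior of V, and harmonic on the interior of V. Suppose the restriction of F to ∂V is an orientation-preserving homeomorphism from ∂V onto ∂W, and suppose the Jacobian determinant of F is nonzero at every point of the interior of V. Then F is injective on V. -/
open Set Filter Topology

/-- The Laplacian `∂²u/∂x² + ∂²u/∂y²` of a function `u : ℝ² → ℝ` at a point `p`. -/
noncomputable def lap2 (u : ℝ × ℝ → ℝ) (p : ℝ × ℝ) : ℝ :=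
  fderiv ℝ (fun q => fderiv ℝ u q (1, 0)) p (1, 0) +
  fderiv ℝ (fun q => fderiv ℝ u q (0, 1)) p (0, 1)

/-- `u` is harmonic on `Ω ⊆ ℝ²`: twice continuously differentiable with vanishing Laplacian. -/
def HarmonicOn2 (u : ℝ × ℝ → ℝ) (Ω : Set (ℝ × ℝ)) : Prop :=
  ContDiffOn ℝ 2 u Ω ∧ ∀ p ∈ Ω, lap2 u p = 0

/-- The 1-periodic loop `γ` winds once counterclockwise around the point `z`: it admits a
continuous polar-coordinate representation around `z` whose angle increases by `2π`
over one period. -/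
def WindsCCWAround (γ : ℝ → ℝ × ℝ) (z : ℝ × ℝ) : Prop :=
  ∃ r θ : ℝ → ℝ, Continuous r ∧ Continuous θ ∧ (∀ t, 0 < r t) ∧
    (∀ t, γ t - z = (r t * Real.cos (θ t), r t * Real.sin (θ t))) ∧
    (∀ t, θ (t + 1) = θ t + 2 * Real.pi)

/-- `γ` is a counterclockwise Jordan parametrization of the boundary of `V`: a 1-periodic
continuous loop, injective on a period, whose image is `frontier V`, and which winds once
counterclockwise around every interior point of `V`. -/
def IsCCWBoundaryParam (γ : ℝ → ℝ × ℝ) (V : Set (ℝ × ℝ)) : Prop :=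
  Continuous γ ∧ (∀ t, γ (t + 1) = γ t) ∧ InjOn γ (Ico (0 : ℝ) 1) ∧
  γ '' Ico (0 : ℝ) 1 = frontier V ∧ ∀ z ∈ interior V, WindsCCWAround γ z

/-- `V` is the closure of a bounded, nonempty, simply connected open subset of `ℝ²`. -/
def IsClosureOfSCRegion (V : Set (ℝ × ℝ)) : Prop :=
  ∃ Ω : Set (ℝ × ℝ), IsOpen Ω ∧ Bornology.IsBounded Ω ∧ Ω.Nonempty ∧
    SimplyConnectedSpace Ω ∧ V = closure Ω

/-- The restriction of `F` to the boundary of `V` is an orientation-preserving homeomorphism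
from `∂V` onto `∂W`: some counterclockwise Jordan parametrization of `∂V` is carried by `F`
to a counterclockwise Jordan parametrization of `∂W`. -/
def OrientPresBoundaryHomeo (F : ℝ × ℝ → ℝ × ℝ) (V W : Set (ℝ × ℝ)) : Prop :=
  ∃ γ : ℝ → ℝ × ℝ, IsCCWBoundaryParam γ V ∧ IsCCWBoundaryParam (F ∘ γ) W

/-- The Jacobian determinant of a map `F = (u, v) : ℝ² → ℝ²` at a point `p`:
`det [[∂u/∂x, ∂u/∂y], [∂v/∂x, ∂v/∂y]]`. -/
noncomputable def jacDet (F : ℝ × ℝ → ℝ × ℝ) (p : ℝ × ℝ) : ℝ :=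
  (fderiv ℝ F p (1, 0)).1 * (fderiv ℝ F p (0, 1)).2 -
  (fderiv ℝ F p (0, 1)).1 * (fderiv ℝ F p (1, 0)).2

/-- The identification of `ℝ × ℝ` with `ℂ`. -/
noncomputable abbrev toComplex : (ℝ × ℝ) ≃L[ℝ] ℂ := Complex.equivRealProdCLM.symm

/-- The 1-periodic loop `f` in `ℂ \ {0}` has winding number `n` around the origin. -/
def HasWinding (f : ℝ → ℂ) (n : ℤ) : Prop :=
  ∃ g : ℝ → ℂ, Continuous g ∧ (∀ t, f t = Complex.exp (g t)) ∧
    ∀ t, g (t + 1) = g t + n * (2 * Real.pi * Complex.I)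

namespace HasWinding

variable {f f' : ℝ → ℂ} {n m : ℤ}

theorem mul (h : HasWinding f n) (h' : HasWinding f' m) :
    HasWinding (fun t => f t * f' t) (n + m) := by
  obtain ⟨g, hg, hfg, hp⟩ := h
  obtain ⟨g', hg', hfg', hp'⟩ := h'
  refine ⟨fun t => g t + g' t, hg.add hg', fun t => ?_, fun t => ?_⟩
  · simp only [hfg, hfg', Complex.exp_add]
  · simp only [hp, hp']
    push_cast
    ring

theorem inv (h : HasWinding f n) : HasWinding (fun t => (f t)⁻¹) (-n) := by
  obtain ⟨g, hg, hfg, hp⟩ := h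
  refine ⟨fun t => -g t, hg.neg, fun t => ?_, fun t => ?_⟩
  · simp only [hfg, Complex.exp_neg]
  · simp only [hp]
    push_cast
    ring

theorem zpow (h : HasWinding f n) (k : ℤ) : HasWinding (fun t => f t ^ k) (k * n) := by
  obtain ⟨g, hg, hfg, hp⟩ := h
  refine ⟨fun t => k * g t, by fun_prop, fun t => ?_, fun t => ?_⟩
  · simp only [hfg, Complex.exp_int_mul]
  · simp only [hp]
    push_cast
    ring

theorem conj (h : HasWinding f n) : HasWinding (fun t => (starRingEnd ℂ) (f t)) (-n) := by
  obtain ⟨g, hg, hfg, hp⟩ := h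
  refine ⟨fun t => (starRingEnd ℂ) (g t), by fun_prop, fun t => ?_, fun t => ?_⟩
  · simp only [hfg, Complex.exp_conj]
  · simp [hp, Complex.conj_ofNat]

theorem prod {ι : Type*} (S : Finset ι) {F : ι → ℝ → ℂ} (h : ∀ i ∈ S, HasWinding (F i) 1) :
    HasWinding (fun t => ∏ i ∈ S, F i t) S.card := by
  classical
  induction S using Finset.induction_on with
  | empty => exact ⟨fun _ => 0, continuous_const, by simp, by simp⟩
  | insert a S ha ih =>
    have := (h a (by simp)).mul (ih fun i hi => h i (by simp [hi]))
    simpa [Finset.prod_insert ha, Finset.card_insert_of_notMem ha, add_comm] using this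

end HasWinding

theorem WindsCCWAround.hasWinding {γ : ℝ → ℝ × ℝ} {z : ℝ × ℝ} (h : WindsCCWAround γ z)
    (hγ : ∀ t, γ (t + 1) = γ t) : HasWinding (fun t => toComplex (γ t - z)) 1 := by
  obtain ⟨r, θ, hr, hθ, hpos, heq, hper⟩ := h
  have hrp (t : ℝ) : r (t + 1) = r t := by
    have h1 := heq (t + 1)
    rw [hγ, heq t, hper, Real.cos_add_two_pi, Real.sin_add_two_pi] at h1
    obtain ⟨h1, h2⟩ := Prod.mk.inj h1
    have := Real.sin_sq_add_cos_sq (θ t)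
    linear_combination (-Real.cos (θ t)) * h1 - Real.sin (θ t) * h2 + (r t - r (t + 1)) * this
  refine ⟨fun t => Real.log (r t) + θ t * Complex.I, ?_, fun t => ?_, fun t => ?_⟩
  · have : Continuous fun t => Real.log (r t) := hr.log fun t => (hpos t).ne'
    fun_prop
  · simp only [heq]
    rw [Complex.exp_add, ← Complex.ofReal_exp, Real.exp_log (hpos t), Complex.exp_mul_I,
      ← Complex.ofReal_cos, ← Complex.ofReal_sin]
    apply Complex.ext <;> simp [-Complex.ofReal_cos, -Complex.ofReal_sin]
  · simp only [hrp, hper]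
    push_cast
    ring

theorem exists_continuous_log {A : Type*} [TopologicalSpace A] [SimplyConnectedSpace A]
    [LocallyPathConnectedSpace A] {G : A → ℂ} (hG : Continuous G) (h0 : ∀ x, G x ≠ 0) :
    ∃ L : A → ℂ, Continuous L ∧ ∀ x, G x = Complex.exp (L x) := by
  obtain ⟨a⟩ : Nonempty A := inferInstance
  obtain ⟨F, ⟨-, hF⟩, -⟩ := Complex.isCoveringMapOn_exp.existsUnique_continuousMap_lifts
    (⟨G, hG⟩ : C(A, ℂ)) (a₀ := a) (e₀ := Complex.log (G a)) (Complex.exp_log (h0 a))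
    (fun x => h0 x)
  exact ⟨F, F.continuous, fun x => (congrFun hF x).symm⟩

theorem eq_of_exp_eq_const {A : Type*} [TopologicalSpace A] [SimplyConnectedSpace A]
    [LocallyPathConnectedSpace A] {φ : A → ℂ} (hφ : Continuous φ) {c : ℂ}
    (h : ∀ t, Complex.exp (φ t) = c) (a b : A) : φ a = φ b := by
  have hu := Complex.isCoveringMapOn_exp.existsUnique_continuousMap_lifts
    (ContinuousMap.const A c) (a₀ := a) (e₀ := φ a) (h a)
    (fun x => by simp [← h a])
  have := hu.unique (y₁ := ⟨φ, hφ⟩) (y₂ := ContinuousMap.const A (φ a))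
    ⟨rfl, funext fun x => h x⟩ ⟨rfl, funext fun x => h a⟩
  exact (congrArg (fun F : C(A, ℂ) => F b) this).symm

/-- A function with winding number zero along a Jordan curve has a logarithm on the curve, which
extends continuously to the ambient space. -/
theorem HasWinding.exists_log_extension {X : Type*} [TopologicalSpace X] [T4Space X]
    {γ : ℝ → X} (hγ : Continuous γ) (hper : ∀ t, γ (t + 1) = γ t) (hinj : InjOn γ (Ico 0 1))
    {f : X → ℂ} (hf : HasWinding (fun t => f (γ t)) 0) :
    ∃ l : X → ℂ, Continuous l ∧ ∀ t, f (γ t) = Complex.exp (l (γ t)) := by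
  obtain ⟨g, hg, hfg, hgp⟩ := hf
  have hγp : Function.Periodic γ 1 := hper
  have hgp' : Function.Periodic g 1 := fun t => by simp [hgp t]
  have hcont : Continuous (hγp.lift : AddCircle (1 : ℝ) → X) :=
    continuous_coinduced_dom.mpr hγ
  have hgcont : Continuous (hgp'.lift : AddCircle (1 : ℝ) → ℂ) :=
    continuous_coinduced_dom.mpr hg
  have : Fact ((0 : ℝ) < 1) := ⟨one_pos⟩
  have hinj' : Function.Injective (hγp.lift : AddCircle (1 : ℝ) → X) := by
    have hsurj (x : AddCircle (1 : ℝ)) : ∃ t ∈ Ico (0 : ℝ) 1, (t : AddCircle (1 : ℝ)) = x := by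
      have : x ∈ ((↑) : ℝ → AddCircle (1 : ℝ)) '' Ico 0 (0 + 1) := by
        rw [AddCircle.coe_image_Ico_eq]; trivial
      simpa using this
    intro x y hxy
    obtain ⟨s, hs, rfl⟩ := hsurj x
    obtain ⟨t, ht, rfl⟩ := hsurj y
    rw [hinj hs ht hxy]
  obtain ⟨l, hl⟩ := ContinuousMap.exists_extension (hcont.isClosedEmbedding hinj')
    (⟨_, hgcont⟩ : C(AddCircle (1 : ℝ), ℂ))
  refine ⟨l, l.continuous, fun t => ?_⟩
  refine (hfg t).trans ?_
  exact congrArg Complex.exp (congrArg (fun F : C(AddCircle (1 : ℝ), ℂ) => F (t : ℝ)) hl).symm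

/-- A continuous nonvanishing function on a closed bounded planar set has winding number zero
along a Jordan parametrization of the boundary. -/
theorem HasWinding.eq_zero_of_ne_zero {V : Set (ℝ × ℝ)} (hV : IsClosed V)
    (hVb : Bornology.IsBounded V) {γ : ℝ → ℝ × ℝ} (hγ : Continuous γ)
    (hper : ∀ t, γ (t + 1) = γ t) (hinj : InjOn γ (Ico 0 1))
    (himg : γ '' Ico (0 : ℝ) 1 = frontier V) {p : ℝ × ℝ} (hp : p ∈ interior V)
    (hw : HasWinding (fun t => toComplex (γ t - p)) 1) {H : ℝ × ℝ → ℂ} (hH : ContinuousOn H V)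
    (hH0 : ∀ x ∈ V, H x ≠ 0) {n : ℤ} (hn : HasWinding (fun t => H (γ t)) n) : n = 0 := by
  classical
  obtain ⟨l, hl, hlγ⟩ := HasWinding.exists_log_extension hγ hper hinj
    (f := fun x => H x * toComplex (x - p) ^ (-n)) (by simpa using hn.mul (hw.zpow (-n)))
  have hne {x : ℝ × ℝ} (hx : x ≠ p) : toComplex (x - p) ≠ 0 := by
    simpa [sub_eq_zero] using hx
  have hG : Continuous fun x => if x ∈ V then H x else toComplex (x - p) ^ n *
      Complex.exp (l x) := by
    refine continuous_if ?_ (by simpa [hV.closure_eq] using hH) ?_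
    · intro x hx
      have hx' : x ∈ frontier V := hx
      have hxp : x ≠ p := fun h => (h ▸ hx').2 hp
      rw [← himg] at hx'
      obtain ⟨t, -, rfl⟩ := hx'
      rw [← hlγ t, mul_left_comm, ← zpow_add₀ (hne hxp)]
      simp
    · intro x hx
      have hx' : x ∈ closure Vᶜ := hx
      have hxp : x ≠ p := by
        rintro rfl
        rw [closure_compl] at hx'
        exact hx' hp
      refine ContinuousAt.continuousWithinAt (ContinuousAt.mul ?_ (by fun_prop))
      exact ContinuousAt.zpow₀ (by fun_prop) _ (Or.inl (hne hxp))
  obtain ⟨L, hL, hGL⟩ := exists_continuous_log hG fun x => by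
    split_ifs with hx
    · exact hH0 x hx
    · exact mul_ne_zero (zpow_ne_zero _ (hne fun h => hx (h ▸ interior_subset hp)))
        (Complex.exp_ne_zero _)
  obtain ⟨R, hR⟩ := (Metric.isBounded_iff_subset_closedBall p).mp hVb
  obtain ⟨C, hC⟩ : ∃ C : ℝ, ∀ x ∈ V, ‖toComplex (x - p)‖ ≤ C :=
    ⟨_, fun x hx => ((toComplex : (ℝ × ℝ) →L[ℝ] ℂ).le_opNorm (x - p)).trans
      (mul_le_mul_of_nonneg_left (by simpa [dist_eq_norm] using hR hx) (norm_nonneg _))⟩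
  set M : ℝ := max C 0 + 1
  have hMpos : 0 < M := by positivity
  set c : ℝ → ℝ × ℝ := fun t => p + toComplex.symm (M * Complex.exp (t * (2 * Real.pi * Complex.I)))
  have hc : Continuous c := by fun_prop
  have hcp (t : ℝ) : toComplex (c t - p) = M * Complex.exp (t * (2 * Real.pi * Complex.I)) := by
    simp only [c, add_sub_cancel_left, ContinuousLinearEquiv.apply_symm_apply]
  have hcV (t : ℝ) : c t ∉ V := fun h => by
    have h1 := hC _ h
    have h2 : ((t : ℂ) * (2 * Real.pi * Complex.I)) = ((t * (2 * Real.pi) : ℝ) : ℂ) * Complex.I := by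
      push_cast; ring
    rw [hcp, norm_mul, h2, Complex.norm_exp_ofReal_mul_I, Complex.norm_real, mul_one,
      Real.norm_of_nonneg hMpos.le] at h1
    have := le_max_left C 0
    simp only [M] at h1
    linarith
  have hconst := eq_of_exp_eq_const (A := ℝ)
    (φ := fun t => L (c t) - l (c t) - n * (t * (2 * Real.pi * Complex.I)))
    (by fun_prop) (c := (M : ℂ) ^ n) (fun t => by
      have := hGL (c t)
      rw [if_neg (hcV t), hcp, mul_zpow, ← Complex.exp_int_mul] at this
      rw [Complex.exp_sub, Complex.exp_sub, ← this]
      field_simp [Complex.exp_ne_zero]) 1 0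
  have hc1 : c 1 = c 0 := by simp [c, Complex.exp_two_pi_mul_I]
  simp only [hc1] at hconst
  have : (n : ℂ) * (2 * Real.pi * Complex.I) = 0 := by
    simpa using hconst
  simpa [Complex.two_pi_I_ne_zero] using this

/-- `f` has at `p` (possibly without being continuous there) values close to a nonzero number:
it stays near `p` in a closed disc which misses the origin. -/
def NearNonzeroAt (f : ℝ × ℝ → ℂ) (p : ℝ × ℝ) : Prop :=
  ∃ (c : ℂ) (ρ : ℝ), 0 ≤ ρ ∧ ρ < ‖c‖ ∧ ∀ᶠ x in 𝓝[≠] p, ‖f x - c‖ ≤ ρ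

theorem NearNonzeroAt.congr {f g : ℝ × ℝ → ℂ} {p : ℝ × ℝ} (hf : NearNonzeroAt f p)
    (h : f =ᶠ[𝓝[≠] p] g) : NearNonzeroAt g p := by
  obtain ⟨c, ρ, h0, h1, h2⟩ := hf
  refine ⟨c, ρ, h0, h1, ?_⟩
  filter_upwards [h, h2] with x hx hx2
  rwa [← hx]

theorem NearNonzeroAt.eventually_ne {f : ℝ × ℝ → ℂ} {p : ℝ × ℝ} (hf : NearNonzeroAt f p) :
    ∀ᶠ x in 𝓝[≠] p, f x ≠ 0 := by
  obtain ⟨c, ρ, -, h1, h2⟩ := hf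
  filter_upwards [h2] with x hx h0
  rw [h0, zero_sub, norm_neg] at hx
  linarith

theorem NearNonzeroAt.mul_continuousAt {f k : ℝ × ℝ → ℂ} {p : ℝ × ℝ} (hf : NearNonzeroAt f p)
    (hk : ContinuousAt k p) (hk0 : k p ≠ 0) : NearNonzeroAt (fun x => f x * k x) p := by
  obtain ⟨c, ρ, h0, h1, h2⟩ := hf
  have hkp : 0 < ‖k p‖ := norm_pos_iff.mpr hk0
  have hlim : Tendsto (fun x => ρ * ‖k x‖ + ‖c‖ * ‖k x - k p‖) (𝓝 p) (𝓝 (ρ * ‖k p‖)) := by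
    have : ContinuousAt (fun x => ρ * ‖k x‖ + ‖c‖ * ‖k x - k p‖) p := by fun_prop
    simpa [ContinuousAt] using this
  have hlt : ρ * ‖k p‖ < ‖c‖ * ‖k p‖ := mul_lt_mul_of_pos_right h1 hkp
  obtain ⟨r, hr1, hr2⟩ := exists_between hlt
  refine ⟨c * k p, r, (by positivity : (0 : ℝ) ≤ ρ * ‖k p‖).trans hr1.le, by rwa [norm_mul], ?_⟩
  filter_upwards [h2, (hlim.eventually_le_const hr1).filter_mono nhdsWithin_le_nhds] with x hx hx2
  calc ‖f x * k x - c * k p‖ = ‖(f x - c) * k x + c * (k x - k p)‖ := by ring_nf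
    _ ≤ ‖f x - c‖ * ‖k x‖ + ‖c‖ * ‖k x - k p‖ := by
      simpa only [norm_mul] using norm_add_le ((f x - c) * k x) (c * (k x - k p))
    _ ≤ ρ * ‖k x‖ + ‖c‖ * ‖k x - k p‖ := by gcongr
    _ ≤ r := hx2

theorem exists_modification_at {V : Set (ℝ × ℝ)} {S : Finset (ℝ × ℝ)} {p : ℝ × ℝ}
    (hp : p ∈ interior V) (hpS : p ∉ S) {f : ℝ × ℝ → ℂ}
    (hc : ContinuousOn f (V \ insert p (S : Set (ℝ × ℝ))))
    (hn : ∀ x ∈ V \ insert p (S : Set (ℝ × ℝ)), f x ≠ 0) (hloc : NearNonzeroAt f p) :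
    ∃ g : ℝ × ℝ → ℂ, ContinuousOn g (V \ S) ∧ (∀ x ∈ V \ (S : Set (ℝ × ℝ)), g x ≠ 0) ∧
      (∀ x ∈ frontier V, g x = f x) ∧ ∀ q ∈ S, g =ᶠ[𝓝 q] f := by
  obtain ⟨c, ρ, hρ, hρc, hev⟩ := hloc
  have hev' : ∀ᶠ x in 𝓝 p, (x ≠ p → ‖f x - c‖ ≤ ρ) ∧ x ∈ interior V ∧
      x ∈ ((S : Set (ℝ × ℝ))ᶜ) :=
    (eventually_nhdsWithin_iff.mp hev).and ((isOpen_interior.eventually_mem hp).and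
      (S.finite_toSet.isClosed.isOpen_compl.eventually_mem (by simpa using hpS)))
  obtain ⟨ε, hε, hball⟩ := Metric.eventually_nhds_iff.mp hev'
  obtain ⟨δ, hδ, hδε⟩ := exists_between hε
  set t : ℝ × ℝ → ℝ := fun x => min (dist x p / δ) 1
  have ht0 (x) : 0 ≤ t x := by positivity
  have ht1 (x) : t x ≤ 1 := min_le_right _ _
  have htc : Continuous t := by fun_prop
  have htp : t p = 0 := by simp [t]
  have hfar {x} (hx : δ ≤ dist x p) : t x = 1 := min_eq_right ((one_le_div hδ).mpr hx)
  set g : ℝ × ℝ → ℂ := fun x => c + t x * (f x - c)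
  have hgfar {x} (hx : δ ≤ dist x p) : g x = f x := by simp [g, hfar hx]
  have hgnear {x} (hx : dist x p < ε) : ‖g x - c‖ ≤ t x * ρ := by
    simp only [g, add_sub_cancel_left, norm_mul, Complex.norm_real, Real.norm_of_nonneg (ht0 x)]
    rcases eq_or_ne x p with rfl | hxp
    · simp [htp]
    · exact mul_le_mul_of_nonneg_left ((hball hx).1 hxp) (ht0 x)
  refine ⟨g, fun x hx => ?_, fun x hx => ?_, fun x hx => ?_, fun q hq => ?_⟩
  · rcases eq_or_ne x p with rfl | hxp
    · refine ContinuousAt.continuousWithinAt ?_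
      have hgx : g x = c := by simp [g, htp]
      rw [ContinuousAt, hgx, tendsto_iff_norm_sub_tendsto_zero]
      refine squeeze_zero' (Eventually.of_forall fun _ => norm_nonneg _)
        (by filter_upwards [Metric.ball_mem_nhds x hε] with y hy using hgnear hy) ?_
      have : ContinuousAt (fun y => t y * ρ) x := by fun_prop
      simpa [ContinuousAt, htp] using this
    · have hx' : x ∈ V \ insert p (S : Set (ℝ × ℝ)) :=
        ⟨hx.1, fun h => h.elim hxp hx.2⟩
      have h1 : ContinuousWithinAt f (V \ S) x := by
        refine (hc x hx').mono_of_mem_nhdsWithin ?_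
        filter_upwards [self_mem_nhdsWithin,
          mem_nhdsWithin_of_mem_nhds (isOpen_ne.mem_nhds hxp)] with y hy hyp
        exact ⟨hy.1, fun h => h.elim hyp hy.2⟩
      have h2 : ContinuousWithinAt (fun x => (t x : ℂ)) (V \ S) x := by fun_prop
      exact continuousWithinAt_const.add (h2.mul (h1.sub continuousWithinAt_const))
  · rcases lt_or_ge (dist x p) δ with h | h
    · intro h0
      have := hgnear (h.trans hδε)
      rw [h0, zero_sub, norm_neg] at this
      have := mul_le_mul_of_nonneg_right (ht1 x) hρ
      linarith
    · rw [hgfar h]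
      refine hn x ⟨hx.1, fun h' => h'.elim (fun h' => ?_) hx.2⟩
      rw [h', dist_self] at h
      linarith
  · refine hgfar (le_of_not_gt fun h => ?_)
    exact hx.2 (hball (h.trans hδε)).2.1
  · have hq' : δ < dist q p := by
      by_contra h
      exact (hball ((not_lt.mp h).trans_lt hδε)).2.2 (by simpa using hq)
    filter_upwards [(isOpen_lt continuous_const (by fun_prop :
      Continuous fun x => dist x p)).mem_nhds hq'] with x hx
    exact hgfar (le_of_lt hx)

theorem exists_nonvanishing_modification {V : Set (ℝ × ℝ)} (S : Finset (ℝ × ℝ))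
    (hS : ∀ p ∈ S, p ∈ interior V) {f : ℝ × ℝ → ℂ} (hc : ContinuousOn f (V \ S))
    (hn : ∀ x ∈ V \ (S : Set (ℝ × ℝ)), f x ≠ 0) (hloc : ∀ p ∈ S, NearNonzeroAt f p) :
    ∃ g : ℝ × ℝ → ℂ, ContinuousOn g V ∧ (∀ x ∈ V, g x ≠ 0) ∧ ∀ x ∈ frontier V, g x = f x := by
  classical
  induction S using Finset.induction_on generalizing f with
  | empty => exact ⟨f, by simpa using hc, by simpa using hn, fun _ _ => rfl⟩
  | insert p S hpS ih =>
    rw [Finset.coe_insert] at hc hn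
    obtain ⟨g, hgc, hgn, hgf, hgS⟩ := exists_modification_at (hS p (by simp)) hpS hc hn
      (hloc p (by simp))
    obtain ⟨k, hkc, hkn, hkf⟩ := ih (fun q hq => hS q (by simp [hq])) hgc hgn fun q hq =>
      (hloc q (by simp [hq])).congr ((hgS q hq).symm.filter_mono nhdsWithin_le_nhds)
    exact ⟨k, hkc, hkn, fun x hx => (hkf x hx).trans (hgf x hx)⟩

/-- If all zeros of a continuous function on a planar region bounded by a Jordan curve are interior
and have local degree one, their number is the winding number of the function along the boundary. -/
theorem HasWinding.eq_card_zeros {V : Set (ℝ × ℝ)} (hV : IsClosed V)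
    (hVb : Bornology.IsBounded V) {γ : ℝ → ℝ × ℝ} (hγ : Continuous γ)
    (hper : ∀ t, γ (t + 1) = γ t) (hinj : InjOn γ (Ico 0 1))
    (himg : γ '' Ico (0 : ℝ) 1 = frontier V) (hne : (interior V).Nonempty)
    (hw : ∀ p ∈ interior V, HasWinding (fun t => toComplex (γ t - p)) 1) {h : ℝ × ℝ → ℂ}
    (hh : ContinuousOn h V) {S : Finset (ℝ × ℝ)} (hS : ∀ p ∈ S, p ∈ interior V)
    (hzero : ∀ x ∈ V, h x = 0 → x ∈ S)
    (hloc : ∀ p ∈ S, NearNonzeroAt (fun x => h x / toComplex (x - p)) p) {n : ℤ}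
    (hn : HasWinding (fun t => h (γ t)) n) : n = S.card := by
  classical
  obtain ⟨p₀, hp₀⟩ := hne
  set P : ℝ × ℝ → ℂ := fun x => ∏ q ∈ S, toComplex (x - q)
  have hP0 (T : Finset (ℝ × ℝ)) {x : ℝ × ℝ} (hx : x ∉ T) :
      ∏ q ∈ T, toComplex (x - q) ≠ 0 := by
    rw [Finset.prod_ne_zero_iff]
    intro q hq h0
    rw [map_eq_zero_iff _ toComplex.injective, sub_eq_zero] at h0
    exact hx (h0 ▸ hq)
  have hPc (T : Finset (ℝ × ℝ)) : Continuous fun x => ∏ q ∈ T, toComplex (x - q) := by fun_prop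
  have hγF (t : ℝ) : γ t ∈ frontier V := by
    rw [← himg]
    refine ⟨Int.fract t, ⟨Int.fract_nonneg t, Int.fract_lt_one t⟩, ?_⟩
    have hp : Function.Periodic γ 1 := hper
    simpa using hp.sub_zsmul_eq (x := t) ⌊t⌋
  obtain ⟨g, hgc, hgn, hgf⟩ := exists_nonvanishing_modification S hS
    (f := fun x => h x * (P x)⁻¹)
    ((hh.mono sdiff_subset).mul ((hPc S).continuousOn.inv₀ fun x hx => hP0 S hx.2))
    (fun x hx => mul_ne_zero (fun h0 => hx.2 (hzero x hx.1 h0)) (inv_ne_zero (hP0 S hx.2)))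
    (fun p hp => by
      refine ((hloc p hp).mul_continuousAt
        (k := fun x => (∏ q ∈ S.erase p, toComplex (x - q))⁻¹)
        ((hPc _).continuousAt.inv₀ (hP0 _ (by simp))) (inv_ne_zero (hP0 _ (by simp)))).congr
        (Eventually.of_forall fun x => ?_)
      have := Finset.mul_prod_erase S (fun q => toComplex (x - q)) hp
      simp only [P]
      rw [← this, mul_inv]
      ring)
  have hz := HasWinding.eq_zero_of_ne_zero hV hVb hγ hper hinj himg hp₀ (hw p₀ hp₀) hgc hgn
    (n := n + -S.card) (by
      rw [funext fun t => hgf _ (hγF t)]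
      exact hn.mul (HasWinding.prod S fun p hp => hw p (hS p hp)).inv)
  omega

/-- The Jacobian determinant of a real-linear map `ℝ × ℝ → ℂ`. -/
noncomputable def linDet (A : ℝ × ℝ →L[ℝ] ℂ) : ℝ :=
  (A (1, 0)).re * (A (0, 1)).im - (A (0, 1)).re * (A (1, 0)).im

/-- At a zero with positive Jacobian, a differentiable function has local degree one. -/
theorem HasFDerivAt.nearNonzeroAt_div {f : ℝ × ℝ → ℂ} {A : ℝ × ℝ →L[ℝ] ℂ} {p : ℝ × ℝ}
    (hf : HasFDerivAt f A p) (hfp : f p = 0) (hA : 0 < linDet A) :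
    NearNonzeroAt (fun x => f x / toComplex (x - p)) p := by
  set α : ℂ := (A (1, 0) - Complex.I * A (0, 1)) / 2
  set β : ℂ := (A (1, 0) + Complex.I * A (0, 1)) / 2
  have hdet : ‖α‖ ^ 2 - ‖β‖ ^ 2 = linDet A := by
    rw [Complex.sq_norm, Complex.sq_norm, Complex.normSq_apply, Complex.normSq_apply]
    simp [α, β, linDet]
    ring
  have hlt : ‖β‖ < ‖α‖ := by
    refine lt_of_pow_lt_pow_left₀ 2 (norm_nonneg _) ?_
    linarith
  have hAx (y : ℝ × ℝ) : A y = α * toComplex y + β * (starRingEnd ℂ) (toComplex y) := by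
    have hy : y = y.1 • ((1, 0) : ℝ × ℝ) + y.2 • ((0, 1) : ℝ × ℝ) := by ext <;> simp
    have h1 : A y = y.1 * A (1, 0) + y.2 * A (0, 1) := by
      conv_lhs => rw [hy]
      rw [map_add, map_smul, map_smul, Complex.real_smul, Complex.real_smul]
    rw [h1]
    apply Complex.ext <;> simp [α, β] <;> ring
  refine ⟨α, (‖α‖ + ‖β‖) / 2, by positivity, by linarith, ?_⟩
  have hε : 0 < (‖α‖ - ‖β‖) / 2 := by linarith
  have hlo := (hasFDerivAt_iff_isLittleO.mp hf).def hε
  filter_upwards [hlo.filter_mono nhdsWithin_le_nhds, self_mem_nhdsWithin] with x hx hxp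
  have hz : toComplex (x - p) ≠ 0 := by
    simpa [sub_eq_zero] using hxp
  set z := toComplex (x - p) with hzdef
  have hle : ‖x - p‖ ≤ ‖z‖ := by
    rw [Prod.norm_def, max_le_iff]
    exact ⟨Complex.abs_re_le_norm z, Complex.abs_im_le_norm z⟩
  rw [hfp, sub_zero] at hx
  rw [div_sub' hz, norm_div, div_le_iff₀ (norm_pos_iff.mpr hz)]
  calc ‖f x - z * α‖ = ‖(f x - A (x - p)) + β * (starRingEnd ℂ) z‖ := by
        rw [hAx, ← hzdef]; ring_nf
    _ ≤ ‖f x - A (x - p)‖ + ‖β * (starRingEnd ℂ) z‖ := norm_add_le _ _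
    _ ≤ (‖α‖ - ‖β‖) / 2 * ‖z‖ + ‖β‖ * ‖z‖ := by
        rw [norm_mul, RCLike.norm_conj]
        gcongr
        exact hx.trans (by gcongr)
    _ = (‖α‖ + ‖β‖) / 2 * ‖z‖ := by ring

/-- A continuous complex function on a region bounded by a Jordan curve, nonvanishing on the
boundary and with positive Jacobian inside, has as many zeros as its winding number. -/
theorem exists_card_zeros_eq {V : Set (ℝ × ℝ)} (hV : IsClosed V)
    (hVb : Bornology.IsBounded V) {γ : ℝ → ℝ × ℝ} (hγ : Continuous γ)
    (hper : ∀ t, γ (t + 1) = γ t) (hinj : InjOn γ (Ico 0 1))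
    (himg : γ '' Ico (0 : ℝ) 1 = frontier V) (hne : (interior V).Nonempty)
    (hw : ∀ p ∈ interior V, HasWinding (fun t => toComplex (γ t - p)) 1) {h : ℝ × ℝ → ℂ}
    (hh : ContinuousOn h V) {A : ℝ × ℝ → ℝ × ℝ →L[ℝ] ℂ}
    (hA : ∀ x ∈ interior V, HasFDerivAt h (A x) x) (hpos : ∀ x ∈ interior V, 0 < linDet (A x))
    {n : ℤ} (hn : HasWinding (fun t => h (γ t)) n) (hfr : ∀ x ∈ frontier V, h x ≠ 0) :
    ∃ S : Finset (ℝ × ℝ), (∀ x ∈ V, h x = 0 → x ∈ S) ∧ n = S.card := by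
  have hint {x} (hx : x ∈ V) (h0 : h x = 0) : x ∈ interior V := by
    by_contra hxi
    exact hfr x ⟨subset_closure hx, hxi⟩ h0
  set Z : Set (ℝ × ℝ) := V ∩ h ⁻¹' {0}
  have hZc : IsCompact Z :=
    (Metric.isCompact_of_isClosed_isBounded hV hVb).of_isClosed_subset
      (hh.preimage_isClosed_of_isClosed hV isClosed_singleton) inter_subset_left
  have hnear (p) (hp : p ∈ Z) : NearNonzeroAt (fun x => h x / toComplex (x - p)) p :=
    (hA p (hint hp.1 hp.2)).nearNonzeroAt_div hp.2 (hpos p (hint hp.1 hp.2))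
  have hZf : Z.Finite := by
    refine hZc.finite (isDiscrete_iff_nhdsNE.mpr fun p hp => ?_)
    rw [← disjoint_iff, disjoint_principal_right]
    filter_upwards [(hnear p hp).eventually_ne] with x hx hxZ
    exact hx (by simp [show h x = 0 from hxZ.2])
  refine ⟨hZf.toFinset, fun x hx h0 => by simpa using ⟨hx, h0⟩, ?_⟩
  exact HasWinding.eq_card_zeros hV hVb hγ hper hinj himg hne hw hh
    (fun p hp => by
      have := hZf.mem_toFinset.mp hp
      exact hint this.1 this.2)
    (fun x hx h0 => hZf.mem_toFinset.mpr ⟨hx, h0⟩)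
    (fun p hp => hnear p (hZf.mem_toFinset.mp hp)) hn

theorem jacDet_ne_zero_range_eq_top {F : ℝ × ℝ → ℝ × ℝ} {p : ℝ × ℝ} (h : jacDet F p ≠ 0) :
    (fderiv ℝ F p).range = ⊤ := by
  rw [LinearMap.range_eq_top]
  intro w
  refine ⟨((w.1 * (fderiv ℝ F p (0, 1)).2 - (fderiv ℝ F p (0, 1)).1 * w.2) / jacDet F p) •
    ((1, 0) : ℝ × ℝ) + (((fderiv ℝ F p (1, 0)).1 * w.2 - w.1 * (fderiv ℝ F p (1, 0)).2) /
    jacDet F p) • ((0, 1) : ℝ × ℝ), ?_⟩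
  rw [map_add, map_smul, map_smul]
  ext <;> simp only [ContinuousLinearMap.coe_coe, Prod.fst_add, Prod.snd_add, Prod.smul_fst,
    Prod.smul_snd, smul_eq_mul] <;> field_simp <;> rw [jacDet] <;> ring

theorem ContDiffAt.mem_interior_of_jacDet_ne_zero {F : ℝ × ℝ → ℝ × ℝ} {V W : Set (ℝ × ℝ)}
    {p : ℝ × ℝ} (hF : ContDiffAt ℝ 1 F p) (hp : p ∈ interior V) (hVW : MapsTo F V W)
    (h : jacDet F p ≠ 0) : F p ∈ interior W := by
  rw [mem_interior_iff_mem_nhds, ← (hF.hasStrictFDerivAt one_ne_zero).map_nhds_eq_of_surj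
    (jacDet_ne_zero_range_eq_top h), mem_map]
  exact mem_of_superset (mem_interior_iff_mem_nhds.mp hp) hVW

theorem IsPreconnected.jacDet_pos_or_neg {F : ℝ × ℝ → ℝ × ℝ} {U : Set (ℝ × ℝ)}
    (hU : IsPreconnected U) (hF : ∀ x ∈ U, ContDiffAt ℝ 1 F x) (h : ∀ x ∈ U, jacDet F x ≠ 0) :
    (∀ x ∈ U, 0 < jacDet F x) ∨ ∀ x ∈ U, jacDet F x < 0 := by
  have hc : ContinuousOn (jacDet F) U := fun x hx => by
    have hd : ContinuousAt (fderiv ℝ F) x := (hF x hx).continuousAt_fderiv one_ne_zero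
    have : ContinuousAt (jacDet F) x := by
      unfold jacDet
      fun_prop
    exact this.continuousWithinAt
  by_contra! hcon
  obtain ⟨⟨a, ha, ha'⟩, b, hb, hb'⟩ := hcon
  obtain ⟨x, hx, hx0⟩ := hU.intermediate_value ha hb hc ⟨ha', hb'⟩
  exact h x hx hx0

/-- Let `F = (u, v) : V → W` with `u, v` continuous on `V`, continuously
differentiable and harmonic on its interior, `F|∂V` an orientation-preserving homeomorphism
onto `∂W`, and nonvanishing Jacobian determinant on the interior of `V`. Then `F` is
injective on `V`. -/
theorem harmonic_map_nonvanishing_jacobian_injective (V W : Set (ℝ × ℝ))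
    (hV : IsClosureOfSCRegion V) (hW : IsClosureOfSCRegion W)
    (u v : ℝ × ℝ → ℝ)
    (hmap : ∀ x ∈ V, (u x, v x) ∈ W)
    (hu : ContinuousOn u V) (hv : ContinuousOn v V)
    (hu1 : ContDiffOn ℝ 1 u (interior V)) (hv1 : ContDiffOn ℝ 1 v (interior V))
    (huh : HarmonicOn2 u (interior V)) (hvh : HarmonicOn2 v (interior V))
    (hbd : OrientPresBoundaryHomeo (fun p => (u p, v p)) V W)
    (hjac : ∀ x ∈ interior V, jacDet (fun p => (u p, v p)) x ≠ 0) :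
    Set.InjOn (fun p => (u p, v p)) V := by
  obtain ⟨Ω, hΩo, hΩb, hΩne, hΩs, hVΩ⟩ := hV
  obtain ⟨γ, ⟨hγ, hper, hinj, himg, hwind⟩, -, hperF, hinjF, himgF, hwindF⟩ := hbd
  set F : ℝ × ℝ → ℝ × ℝ := fun p => (u p, v p)
  have hVc : IsClosed V := hVΩ ▸ isClosed_closure
  have hVb : Bornology.IsBounded V := hVΩ ▸ hΩb.closure
  have hΩV : Ω ⊆ interior V := interior_maximal (hVΩ ▸ subset_closure) hΩo
  have hpre : IsPreconnected (interior V) :=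
    (isPreconnected_iff_preconnectedSpace.mpr inferInstance : IsPreconnected Ω).subset_closure hΩV
      (hVΩ ▸ interior_subset)
  have hFc : ContinuousOn F V := hu.prodMk hv
  have hF1 (x) (hx : x ∈ interior V) : ContDiffAt ℝ 1 F x :=
    (hu1.contDiffAt (isOpen_interior.mem_nhds hx)).prodMk
      (hv1.contDiffAt (isOpen_interior.mem_nhds hx))
  have hFint (x) (hx : x ∈ interior V) : F x ∈ interior W :=
    (hF1 x hx).mem_interior_of_jacDet_ne_zero hx hmap (hjac x hx)
  have hFfr (x) (hx : x ∈ frontier V) : F x ∈ frontier W := by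
    rw [← himg] at hx
    obtain ⟨t, ht, rfl⟩ := hx
    rw [← himgF]
    exact ⟨t, ht, rfl⟩
  have hw (p) (hp : p ∈ interior V) := (hwind p hp).hasWinding hper
  have hder (z : ℝ × ℝ) (x) (hx : x ∈ interior V) : HasFDerivAt (fun x => toComplex (F x - z))
      ((toComplex : (ℝ × ℝ) →L[ℝ] ℂ).comp (fderiv ℝ F x)) x :=
    toComplex.toContinuousLinearMap.hasFDerivAt.comp x
      (((hF1 x hx).differentiableAt one_ne_zero).hasFDerivAt.sub_const z)
  have hhc (z : ℝ × ℝ) : ContinuousOn (fun x => toComplex (F x - z)) V :=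
    toComplex.continuous.comp_continuousOn (hFc.sub continuousOn_const)
  have hfr (z) (hz : z ∈ interior W) (x) (hx : x ∈ frontier V) : toComplex (F x - z) ≠ 0 := by
    intro h0
    rw [map_eq_zero_iff _ toComplex.injective, sub_eq_zero] at h0
    exact (hFfr x hx).2 (h0 ▸ hz)
  have hint (x) (hx : x ∈ interior V) (y) (hy : y ∈ interior V) (hxy : F x = F y) : x = y := by
    have hz := hFint x hx
    rcases hpre.jacDet_pos_or_neg hF1 hjac with hpos | hneg
    · obtain ⟨S, hS, hcard⟩ := exists_card_zeros_eq hVc hVb hγ hper hinj himg (hΩne.mono hΩV) hw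
        (hhc (F x)) (hder (F x)) (fun a ha => hpos a ha) ((hwindF _ hz).hasWinding hperF)
        (hfr _ hz)
      have hS1 : S.card ≤ 1 := by omega
      exact Finset.card_le_one.mp hS1 x (hS x (interior_subset hx) (by simp)) y
        (hS y (interior_subset hy) (by simp [hxy]))
    · obtain ⟨S, -, hcard⟩ := exists_card_zeros_eq hVc hVb hγ hper hinj himg (hΩne.mono hΩV) hw
        (Complex.continuous_conj.comp_continuousOn (hhc (F x)))
        (fun a ha => Complex.conjCLE.toContinuousLinearMap.hasFDerivAt.comp a (hder (F x) a ha))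
        (fun a ha => by
          have := hneg a ha
          simp only [jacDet] at this
          simp [linDet]
          linarith)
        ((hwindF _ hz).hasWinding hperF).conj
        (fun a ha => (map_ne_zero (starRingEnd ℂ)).mpr (hfr _ hz a ha))
      omega
  have hmix (x) (hx : x ∈ interior V) (y) (hy : y ∈ frontier V) : F x ≠ F y := fun h =>
    (hFfr y hy).2 (h ▸ hFint x hx)
  have hcases (x) (hx : x ∈ V) : x ∈ interior V ∨ x ∈ frontier V := by
    by_cases h : x ∈ interior V
    · exact Or.inl h
    · exact Or.inr ⟨subset_closure hx, h⟩
  intro x hx y hy hxy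
  rcases hcases x hx with hx | hx <;> rcases hcases y hy with hy | hy
  · exact hint x hx y hy hxy
  · exact (hmix x hx y hy hxy).elim
  · exact (hmix y hy x hx hxy.symm).elim
  · rw [← himg] at hx hy
    obtain ⟨s, hs, rfl⟩ := hx
    obtain ⟨t, ht, rfl⟩ := hy
    rw [hinjF hs ht hxy]
end

section
/- Let V and W be compact subsets of ℝ² that are closures of bounded simply connected open sets, with W convex. Let F = (u, v) : V → ℝ² where u and v are continuous on V, continuously differentiable on the interior of V, and harmonic on the interior of V, and suppose the restriction of F to ∂V is an orientation-preserving homeomorphism from ∂V onto ∂W. Then the Jacobian determinant of F is nonzero at every point of the interior of V; equivalently, the gradients ∇u(x) and ∇v(x) are linearly independent for every x in the interior of V. -/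
open Set Filter Topology

open InnerProductSpace in
theorem HarmonicAt.exists_analyticAt_re_eq {h : ℂ → ℝ} {z : ℂ} (hh : HarmonicAt h z) :
    ∃ f : ℂ → ℂ, AnalyticAt ℂ f z ∧ ∀ᶠ y in 𝓝 z, (f y).re = h y := by
  obtain ⟨r, hr, hball⟩ := Metric.eventually_nhds_iff_ball.1 hh.eventually
  obtain ⟨f, hf, hre⟩ := HarmonicOnNhd.exists_analyticOnNhd_ball_re_eq (f := h) hball
  exact ⟨f, hf z (Metric.mem_ball_self hr),
    eventually_of_mem (Metric.ball_mem_nhds z hr) fun y hy => hre hy⟩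

open InnerProductSpace in
theorem HarmonicAt.eventually_eq_of_isLocalMax {h : ℂ → ℝ} {z : ℂ} (hh : HarmonicAt h z)
    (hz : IsLocalMax h z) : ∀ᶠ y in 𝓝 z, h y = h z := by
  obtain ⟨f, hf, hre⟩ := HarmonicAt.exists_analyticAt_re_eq hh
  have hmax : IsLocalMax (norm ∘ fun y => Complex.exp (f y)) z := by
    filter_upwards [hz, hre] with y hy hfy
    simpa [Complex.norm_exp, hfy, hre.self_of_nhds] using hy
  have hd : ∀ᶠ y in 𝓝 z, DifferentiableAt ℂ (fun y => Complex.exp (f y)) y :=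
    hf.eventually_analyticAt.mono fun y hy => hy.differentiableAt.cexp
  filter_upwards [Complex.eventually_eq_of_isLocalMax_norm hd hmax, hre] with y hy hfy
  have := congrArg norm hy
  simpa [Complex.norm_exp, hfy, hre.self_of_nhds] using this

open InnerProductSpace in
theorem exists_mem_frontier_inter_connectedComponentIn_pos {V : Set ℂ} (hV : IsCompact V)
    {H : ℂ → ℝ} (hH : Continuous H) (hharm : HarmonicOnNhd H (interior V)) {p : ℂ}
    (hp : p ∈ interior V) (hpos : 0 < H p) :
    ∃ q ∈ frontier V, q ∈ connectedComponentIn {z | 0 < H z} p := by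
  set S : Set ℂ := {z | 0 < H z}
  set C := connectedComponentIn S p with hC
  have hSo : IsOpen S := isOpen_lt continuous_const hH
  have hCo : IsOpen C := hSo.connectedComponentIn
  have hCpre : IsPreconnected C := isPreconnected_connectedComponentIn
  have hpC : p ∈ C := mem_connectedComponentIn hpos
  by_contra! hno
  have hCint : C ⊆ interior V := by
    refine hCpre.subset_left_of_subset_union isOpen_interior hV.isClosed.isOpen_compl
      (disjoint_compl_right.mono_left interior_subset) (fun y hy => ?_) ⟨p, hpC, hp⟩
    by_cases hyV : y ∈ V
    · by_contra hn
      exact hno y ⟨subset_closure hyV, fun hyi => hn (Or.inl hyi)⟩ hy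
    · exact Or.inr hyV
  have hCV : C ⊆ V := hCint.trans interior_subset
  have hmem : ∀ m ∈ closure C, 0 < H m → m ∈ C := by
    intro m hm hmpos
    have hins : IsPreconnected (insert m C) :=
      hCpre.subset_closure (subset_insert m C) (insert_subset hm subset_closure)
    exact hins.subset_connectedComponentIn (mem_insert_of_mem m hpC)
      (insert_subset hmpos (connectedComponentIn_subset S p)) (mem_insert m C)
  have hcomp : IsCompact (closure C) :=
    hV.of_isClosed_subset isClosed_closure (closure_minimal hCV hV.isClosed)
  obtain ⟨m, hm, hmax⟩ := hcomp.exists_isMaxOn ⟨p, subset_closure hpC⟩ hH.continuousOn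
  have hmpos : 0 < H m := hpos.trans_le (hmax (subset_closure hpC))
  set M : Set ℂ := closure C ∩ {z | H z = H m} with hM
  have hMcl : IsClosed M := isClosed_closure.inter (isClosed_eq hH continuous_const)
  have hMo : IsOpen M := by
    rw [isOpen_iff_mem_nhds]
    rintro z ⟨hz, hzm⟩
    have hzC : z ∈ C := hmem z hz (by rw [hzm]; exact hmpos)
    have hloc : IsLocalMax H z := by
      filter_upwards [hCo.mem_nhds hzC] with y hy
      rw [hzm]
      exact hmax (subset_closure hy)
    filter_upwards [hCo.mem_nhds hzC,
      HarmonicAt.eventually_eq_of_isLocalMax (hharm z (hCint hzC)) hloc] with y hy hyz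
    exact ⟨subset_closure hy, hyz.trans hzm⟩
  have hMuniv : M = univ := IsClopen.eq_univ ⟨hMcl, hMo⟩ ⟨m, hm, rfl⟩
  have : IsCompact (univ : Set ℂ) := hMuniv ▸ hcomp.of_isClosed_subset hMcl inter_subset_left
  exact noncompact_univ ℂ this

open InnerProductSpace in
theorem exists_alternating_rays {h : ℂ → ℝ} {x : ℂ} (hh : HarmonicAt h x) (hx : h x = 0)
    (hd : fderiv ℝ h x = 0) (hne : ¬ ∀ᶠ y in 𝓝 x, h y = 0)
    {U : Set ℂ} (hU : U ∈ 𝓝 x) :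
    ∃ n : ℕ, 2 ≤ n ∧ ∃ b : ℂ, b ≠ 0 ∧ ∀ s : ℝ, 0 < s → s ≤ 1 → ∀ w : ℂ,
      (w ^ n = 1 → x + b * (s * w) ∈ U ∧ 0 < h (x + b * (s * w))) ∧
      (w ^ n = -1 → x + b * (s * w) ∈ U ∧ h (x + b * (s * w)) < 0) := by
  obtain ⟨f₀, hf₀, hre₀⟩ := HarmonicAt.exists_analyticAt_re_eq hh
  obtain ⟨f, hf, hre, hfx⟩ : ∃ f : ℂ → ℂ, AnalyticAt ℂ f x ∧ (∀ᶠ y in 𝓝 x, (f y).re = h y) ∧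
      f x = 0 := by
    refine ⟨fun y => f₀ y - f₀ x, hf₀.sub analyticAt_const, ?_, sub_self _⟩
    filter_upwards [hre₀] with y hy
    simp [hy, hre₀.self_of_nhds, hx]
  have hfne : ¬ ∀ᶠ y in 𝓝 x, f y = 0 := by
    refine fun hz => hne ?_
    filter_upwards [hz, hre] with y hy hy'
    simp [← hy', hy]
  have hderiv : deriv f x = 0 := by
    have h1 : HasFDerivAt (𝕜 := ℝ) (fun y => (f y).re)
        (Complex.reCLM.comp ((fderiv ℂ f x).restrictScalars ℝ)) x :=
      Complex.reCLM.hasFDerivAt.comp x (hf.differentiableAt.hasFDerivAt.restrictScalars ℝ)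
    have h2 : Complex.reCLM.comp ((fderiv ℂ f x).restrictScalars ℝ) = 0 := by
      rw [← hd, ← Filter.EventuallyEq.fderiv_eq hre]
      exact h1.fderiv.symm
    have e1 := DFunLike.congr_fun h2 1
    have e2 := DFunLike.congr_fun h2 Complex.I
    have h3 : fderiv ℂ f x Complex.I = Complex.I * fderiv ℂ f x 1 := by
      have := (fderiv ℂ f x).map_smul Complex.I 1
      simpa only [smul_eq_mul, mul_one] using this
    simp [h3] at e1 e2
    apply Complex.ext <;> simpa using by assumption
  obtain ⟨n, g, hg, hgx, hfg⟩ := hf.exists_eventuallyEq_pow_smul_nonzero_iff.2 hfne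
  have hn : 2 ≤ n := by
    by_contra! hlt
    interval_cases n
    · have := hfg.self_of_nhds
      simp [hfx] at this
      exact hgx this.symm
    · have h1 : HasDerivAt (fun z => (z - x) ^ 1 • g z) (g x) x := by
        have := ((hasDerivAt_id x).sub_const x).mul hg.differentiableAt.hasDerivAt
        simp only [id_eq, sub_self, zero_mul, add_zero, one_mul] at this
        simpa only [pow_one, smul_eq_mul] using! this
      have h2 := Filter.EventuallyEq.deriv_eq hfg
      rw [h1.deriv, hderiv] at h2
      exact hgx h2.symm
  have hn0 : n ≠ 0 := by omega
  obtain ⟨a, ha⟩ := IsAlgClosed.exists_pow_nat_eq (g x)⁻¹ (Nat.pos_of_ne_zero hn0)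
  have ha0 : a ≠ 0 := by
    rintro rfl
    rw [zero_pow hn0] at ha
    exact inv_ne_zero hgx ha.symm
  have hev : ∀ᶠ y in 𝓝 x, 0 < (a ^ n * g y).re := by
    have hc : ContinuousAt (fun y => (a ^ n * g y).re) x :=
      Complex.continuous_re.continuousAt.comp (continuousAt_const.mul hg.continuousAt)
    refine hc.eventually_const_lt ?_
    simp [ha, hgx]
  obtain ⟨r, hr, hball⟩ := Metric.eventually_nhds_iff_ball.1 ((hev.and hU).and (hre.and hfg))
  set δ : ℝ := r / (2 * ‖a‖)
  have hapos : 0 < ‖a‖ := norm_pos_iff.2 ha0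
  have hδ : 0 < δ := by positivity
  have key : ∀ s : ℝ, 0 < s → s ≤ 1 → ∀ w : ℂ, ‖w‖ = 1 →
      x + a * δ * (s * w) ∈ U ∧ ∃ t : ℝ, 0 < t ∧
        ∀ ε : ℝ, w ^ n = ε → h (x + a * δ * (s * w)) = ε * t := by
    intro s hs hs1 w hw
    obtain ⟨⟨h1, hmem⟩, h2, h3⟩ := hball (x + a * δ * (s * w)) (by
      rw [mem_ball_iff_norm, add_sub_cancel_left]
      simp only [norm_mul, Complex.norm_real, Real.norm_eq_abs, abs_of_pos hδ, abs_of_pos hs, hw]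
      have : ‖a‖ * δ = r / 2 := by simp only [δ]; field_simp
      rw [this]
      nlinarith)
    refine ⟨hmem, (δ * s) ^ n * (a ^ n * g (x + a * δ * (s * w))).re, by positivity, ?_⟩
    intro ε hε
    rw [← h2, h3, add_sub_cancel_left, smul_eq_mul]
    have : (a * δ * (s * w)) ^ n * g (x + a * δ * (s * w)) =
        ((ε * (δ * s) ^ n : ℝ) : ℂ) * (a ^ n * g (x + a * δ * (s * w))) := by
      push_cast
      rw [← hε]
      ring
    rw [this, Complex.re_ofReal_mul]
    ring
  refine ⟨n, hn, a * δ, mul_ne_zero ha0 (by exact_mod_cast hδ.ne'), fun s hs hs1 w => ⟨?_, ?_⟩⟩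
  · intro hw
    obtain ⟨hmem, t, ht, h1⟩ := key s hs hs1 w (Complex.norm_eq_one_of_pow_eq_one hw hn0)
    refine ⟨hmem, ?_⟩
    rw [h1 1 (by simpa using hw)]
    linarith
  · intro hw
    have hw' : w ^ (n * 2) = 1 := by rw [pow_mul, hw]; norm_num
    obtain ⟨hmem, t, ht, h1⟩ := key s hs hs1 w (Complex.norm_eq_one_of_pow_eq_one hw' (by omega))
    refine ⟨hmem, ?_⟩
    rw [h1 (-1) (by simpa using hw)]
    linarith

theorem arg_one_sub_exp_mul_I {τ : ℝ} (h0 : 0 < τ) (h1 : τ < 2 * Real.pi) :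
    Complex.arg (1 - Complex.exp (τ * Complex.I)) = (τ - Real.pi) / 2 := by
  have hsin : 0 < 2 * Real.sin (τ / 2) := by
    have := Real.sin_pos_of_pos_of_lt_pi (x := τ / 2) (by linarith) (by linarith)
    linarith
  have key : 1 - Complex.exp (τ * Complex.I) =
      ((2 * Real.sin (τ / 2) : ℝ) : ℂ) *
        (Complex.cos (((τ - Real.pi) / 2 : ℝ) : ℂ) +
          Complex.sin (((τ - Real.pi) / 2 : ℝ) : ℂ) * Complex.I) := by
    have e : (τ - Real.pi) / 2 = τ / 2 - Real.pi / 2 := by ring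
    have hc : Real.cos τ = 1 - 2 * Real.sin (τ / 2) ^ 2 := by
      have h2 := Real.cos_two_mul (τ / 2)
      have h3 := Real.sin_sq_add_cos_sq (τ / 2)
      rw [show 2 * (τ / 2) = τ by ring] at h2
      linarith
    have hs : Real.sin τ = 2 * Real.sin (τ / 2) * Real.cos (τ / 2) := by
      rw [← Real.sin_two_mul]
      congr 1
      ring
    rw [e, ← Complex.ofReal_cos, ← Complex.ofReal_sin, Real.cos_sub_pi_div_two,
      Real.sin_sub_pi_div_two, Complex.exp_mul_I, ← Complex.ofReal_cos, ← Complex.ofReal_sin,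
      hc, hs]
    push_cast
    ring
  rw [key, Complex.arg_mul_cos_add_sin_mul_I hsin]
  constructor <;> linarith

theorem arg_one_sub_exp_neg_mul_I {τ : ℝ} (h0 : 0 < τ) (h1 : τ < 2 * Real.pi) :
    Complex.arg (1 - Complex.exp (-(τ * Complex.I))) = (Real.pi - τ) / 2 := by
  have h := arg_one_sub_exp_mul_I (τ := 2 * Real.pi - τ) (by linarith) (by linarith)
  have e : Complex.exp (((2 * Real.pi - τ : ℝ) : ℂ) * Complex.I) =
      Complex.exp (-(τ * Complex.I)) := by
    rw [← Complex.exp_periodic (-(τ * Complex.I))]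
    congr 1
    push_cast
    ring
  rw [e] at h
  rw [h]
  ring

/-- Two continuous logarithms of the same function on a preconnected space have the same
increments. -/
theorem sub_eq_sub_of_exp_eq {X : Type*} [TopologicalSpace X] [PreconnectedSpace X]
    {f g : X → ℂ} (hf : Continuous f) (hg : Continuous g)
    (h : ∀ x, Complex.exp (f x) = Complex.exp (g x)) (x y : X) :
    f x - f y = g x - g y := by
  have hpre : IsPreconnected (range fun x => (f x - g x) / (2 * Real.pi * Complex.I)) :=
    isPreconnected_range (by fun_prop)
  have hsub : (range fun x => (f x - g x) / (2 * Real.pi * Complex.I)) ⊆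
      range ((↑) : ℤ → ℂ) := by
    rintro _ ⟨x, rfl⟩
    obtain ⟨n, hn⟩ := Complex.exp_eq_exp_iff_exists_int.1 (h x)
    refine ⟨n, ?_⟩
    have : (2 * Real.pi * Complex.I : ℂ) ≠ 0 := Complex.two_pi_I_ne_zero
    simp only [hn]
    field_simp
    ring
  have hss : (range fun x => (f x - g x) / (2 * Real.pi * Complex.I)).Subsingleton :=
    ((countable_range _).mono hsub).isTotallyDisconnected _ Subset.rfl hpre
  have := hss ⟨x, rfl⟩ ⟨y, rfl⟩
  have h2 : (2 * Real.pi * Complex.I : ℂ) ≠ 0 := Complex.two_pi_I_ne_zero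
  simp only [div_left_inj' h2] at this
  linear_combination this

theorem one_sub_div_mem_slitPlane {q w : ℂ} (hw : w ≠ 0)
    (h : ∀ s : ℝ, 0 < s → s ≤ 1 → w ≠ s * q) : 1 - q / w ∈ Complex.slitPlane := by
  by_contra hn
  rw [Complex.mem_slitPlane_iff_not_le_zero, not_not] at hn
  obtain ⟨r, hr⟩ : ∃ r : ℝ, 1 - q / w = r := ⟨(1 - q / w).re, by
    apply Complex.ext <;> simp [(Complex.le_def.1 hn).2]⟩
  have hr0 : r ≤ 0 := by rw [hr] at hn; exact_mod_cast hn
  refine h (1 - r)⁻¹ (inv_pos.2 (by linarith)) ?_ ?_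
  · exact inv_le_one_of_one_le₀ (by linarith)
  · have h1 : (1 - r : ℂ) ≠ 0 := by
      have : (1 - r : ℝ) ≠ 0 := by linarith
      exact_mod_cast this
    have : q = (1 - r) * w := by
      rw [← hr]; field_simp; ring
    rw [this]; push_cast; field_simp

theorem exp_log_one_sub_div_sub {a b w : ℂ} (hw : w ≠ 0) (ha : w ≠ a) (hb : w ≠ b) :
    Complex.exp (Complex.log (1 - a / w) - Complex.log (1 - b / w)) = (w - a) / (w - b) := by
  have ha' : w - a ≠ 0 := sub_ne_zero.2 ha
  have hb' : w - b ≠ 0 := sub_ne_zero.2 hb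
  have e1 : 1 - a / w = (w - a) / w := by field_simp
  have e2 : 1 - b / w = (w - b) / w := by field_simp
  rw [Complex.exp_sub, e1, e2, Complex.exp_log (div_ne_zero ha' hw),
    Complex.exp_log (div_ne_zero hb' hw)]
  field_simp

/-- Four rays from the origin, alternately in two disjoint sets `P` and `N`, at angles
`-θ, 0, θ, 2θ`: the two rays of `P` and the two rays of `N` cannot both be joined. -/
theorem not_joinedIn_alternating_rays {P N : Set ℂ} (hPN : Disjoint P N) (hP0 : (0 : ℂ) ∉ P)
    (hN0 : (0 : ℂ) ∉ N) {θ : ℝ} (h0 : 0 < θ) (h1 : θ ≤ Real.pi / 2)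
    (hp₁ : ∀ s : ℝ, 0 < s → s ≤ 1 → (s * 1 : ℂ) ∈ P)
    (hp₂ : ∀ s : ℝ, 0 < s → s ≤ 1 → (s * Complex.exp ((2 * θ : ℝ) * Complex.I) : ℂ) ∈ P)
    (hq₁ : ∀ s : ℝ, 0 < s → s ≤ 1 → (s * Complex.exp (θ * Complex.I) : ℂ) ∈ N)
    (hq₂ : ∀ s : ℝ, 0 < s → s ≤ 1 → (s * Complex.exp (-(θ * Complex.I)) : ℂ) ∈ N)
    (hP : JoinedIn P 1 (Complex.exp ((2 * θ : ℝ) * Complex.I)))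
    (hN : JoinedIn N (Complex.exp (θ * Complex.I)) (Complex.exp (-(θ * Complex.I)))) :
    False := by
  have hpi := Real.pi_pos
  set p₂ := Complex.exp ((2 * θ : ℝ) * Complex.I) with hp₂def
  set q₁ := Complex.exp (θ * Complex.I) with hq₁def
  set q₂ := Complex.exp (-(θ * Complex.I)) with hq₂def
  obtain ⟨c, hc⟩ := hP
  obtain ⟨d, hd⟩ := hN
  have hne : ∀ x ∈ P, ∀ y ∈ N, x ≠ y := fun x hx y hy hxy =>
    Set.disjoint_left.1 hPN hx (hxy ▸ hy)
  have hslit : ∀ {A B : Set ℂ} {q : ℂ}, (∀ x ∈ A, ∀ y ∈ B, x ≠ y) → (0 : ℂ) ∉ A →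
      (∀ s : ℝ, 0 < s → s ≤ 1 → (s * q : ℂ) ∈ B) → ∀ w ∈ A, 1 - q / w ∈ Complex.slitPlane :=
    fun hAB hA hB w hw => one_sub_div_mem_slitPlane (fun h => hA (h ▸ hw))
      fun s hs hs1 => hAB w hw _ (hB s hs hs1)
  have hne' : ∀ x ∈ N, ∀ y ∈ P, x ≠ y := fun x hx y hy => (hne y hy x hx).symm
  have hlogc : ∀ {A : Set ℂ} {q x y : ℂ} (γ : Path x y), (∀ t, γ t ∈ A) → (0 : ℂ) ∉ A →
      (∀ w ∈ A, 1 - q / w ∈ Complex.slitPlane) →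
      Continuous fun t => Complex.log (1 - q / γ t) := fun γ hγ hA hs =>
    Continuous.clog (continuous_const.sub (continuous_const.div γ.continuous
      fun t h => hA (h ▸ hγ t))) fun t => hs _ (hγ t)
  -- a continuous logarithm of `c s - d t` on the square
  obtain ⟨E, hEc, hE⟩ : ∃ E : unitInterval × unitInterval → ℂ, Continuous E ∧
      ∀ s t, Complex.exp (E (s, t)) = c s - d t := by
    let π : ℝ → unitInterval := projIcc 0 1 zero_le_one
    have hπ : Continuous π := continuous_projIcc
    obtain ⟨E, ⟨-, hE⟩, -⟩ := Complex.isCoveringMapOn_exp.existsUnique_continuousMap_lifts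
      (A := ℝ × ℝ) ⟨fun x => c (π x.1) - d (π x.2), by fun_prop⟩ (a₀ := (0, 0))
      (Complex.exp_log (sub_ne_zero.2 (hne _ (hc _) _ (hd _))))
      (fun x => sub_ne_zero.2 (hne _ (hc (π x.1)) _ (hd (π x.2))))
    refine ⟨fun x => E (x.1, x.2), by fun_prop, fun s t => ?_⟩
    have := congrFun hE ((s : ℝ), (t : ℝ))
    simpa [π, projIcc_val] using this
  have mem1 : (1 : ℂ) ∈ P := by simpa using hc 0
  have memp₂ : p₂ ∈ P := by simpa using hc 1
  have memq₁ : q₁ ∈ N := by simpa using hd 0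
  have memq₂ : q₂ ∈ N := by simpa using hd 1
  have hcs := sub_eq_sub_of_exp_eq (X := unitInterval)
    (f := fun s => E (s, 0) - E (s, 1))
    (g := fun s => Complex.log (1 - q₁ / c s) - Complex.log (1 - q₂ / c s)) (by fun_prop)
    ((hlogc c hc hP0 (hslit hne hP0 hq₁)).sub (hlogc c hc hP0 (hslit hne hP0 hq₂)))
    (fun s => by
      rw [exp_log_one_sub_div_sub (fun h => hP0 (h ▸ hc s)) (hne _ (hc s) _ memq₁)
        (hne _ (hc s) _ memq₂), Complex.exp_sub, hE, hE]
      simp) 1 0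
  have hds := sub_eq_sub_of_exp_eq (X := unitInterval)
    (f := fun t => E (0, t) - E (1, t))
    (g := fun t => Complex.log (1 - 1 / d t) - Complex.log (1 - p₂ / d t)) (by fun_prop)
    ((hlogc d hd hN0 (hslit hne' hN0 hp₁)).sub (hlogc d hd hN0 (hslit hne' hN0 hp₂)))
    (fun t => by
      rw [exp_log_one_sub_div_sub (fun h => hN0 (h ▸ hd t)) (hne' _ (hd t) _ mem1)
        (hne' _ (hd t) _ memp₂), Complex.exp_sub, hE, hE, ← neg_sub (d t), ← neg_sub (d t),
        neg_div_neg_eq]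
      simp) 1 0
  simp only [Path.source, Path.target] at hcs hds
  have hq₁p₂ : q₁ / p₂ = Complex.exp (-(θ * Complex.I)) := by
    rw [hq₁def, hp₂def, ← Complex.exp_sub]; congr 1; push_cast; ring
  have hq₂p₂ : q₂ / p₂ = Complex.exp (-((3 * θ : ℝ) * Complex.I)) := by
    rw [hq₂def, hp₂def, ← Complex.exp_sub]; congr 1; push_cast; ring
  have h1q₂ : 1 / q₂ = Complex.exp (θ * Complex.I) := by
    rw [hq₂def, one_div, ← Complex.exp_neg, neg_neg]
  have h1q₁ : 1 / q₁ = Complex.exp (-(θ * Complex.I)) := by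
    rw [hq₁def, one_div, ← Complex.exp_neg]
  have hp₂q₂ : p₂ / q₂ = Complex.exp ((3 * θ : ℝ) * Complex.I) := by
    rw [hq₂def, hp₂def, ← Complex.exp_sub]; congr 1; push_cast; ring
  have hp₂q₁ : p₂ / q₁ = Complex.exp (θ * Complex.I) := by
    rw [hq₁def, hp₂def, ← Complex.exp_sub]; congr 1; push_cast; ring
  rw [hq₁p₂, hq₂p₂, div_one, div_one, hq₁def, hq₂def] at hcs
  rw [h1q₂, h1q₁, hp₂q₂, hp₂q₁] at hds
  have him := congrArg Complex.im hcs
  have him' := congrArg Complex.im hds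
  simp only [Complex.sub_im, Complex.log_im] at him him'
  rw [arg_one_sub_exp_neg_mul_I h0 (by linarith), arg_one_sub_exp_mul_I h0 (by linarith),
    arg_one_sub_exp_neg_mul_I (by linarith) (by linarith)] at him
  rw [arg_one_sub_exp_neg_mul_I h0 (by linarith), arg_one_sub_exp_mul_I h0 (by linarith),
    arg_one_sub_exp_mul_I (by linarith) (by linarith)] at him'
  linarith

open InnerProductSpace in
theorem joinedIn_setOf_pos {V : Set ℂ} (hV : IsCompact V) {H : ℂ → ℝ} (hH : Continuous H)
    (hharm : HarmonicOnNhd H (interior V))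
    (hpre : IsPreconnected (frontier V ∩ {z | 0 < H z})) {p p' : ℂ}
    (hp : p ∈ interior V) (hpos : 0 < H p) (hp' : p' ∈ interior V) (hpos' : 0 < H p') :
    JoinedIn {z | 0 < H z} p p' := by
  set S : Set ℂ := {z | 0 < H z}
  have hSo : IsOpen S := isOpen_lt continuous_const hH
  obtain ⟨q, hqV, hq⟩ :=
    exists_mem_frontier_inter_connectedComponentIn_pos hV hH hharm hp hpos
  obtain ⟨q', hqV', hq'⟩ :=
    exists_mem_frontier_inter_connectedComponentIn_pos hV hH hharm hp' hpos'
  have hqS : q ∈ S := connectedComponentIn_subset S p hq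
  have hqS' : q' ∈ S := connectedComponentIn_subset S p' hq'
  have hqq' : q' ∈ connectedComponentIn S q :=
    hpre.subset_connectedComponentIn ⟨hqV, hqS⟩ inter_subset_right ⟨hqV', hqS'⟩
  have hpp' : p' ∈ connectedComponentIn S p := by
    rw [connectedComponentIn_eq hq, connectedComponentIn_eq hqq', ← connectedComponentIn_eq hq']
    exact mem_connectedComponentIn hpos'
  have hpath : IsPathConnected (connectedComponentIn S p) :=
    (IsOpen.isConnected_iff_isPathConnected hSo.connectedComponentIn).1
      (isConnected_connectedComponentIn_iff.2 hpos)
  exact (hpath.joinedIn p (mem_connectedComponentIn hpos) p' hpp').mono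
    (connectedComponentIn_subset S p)

theorem JoinedIn.of_affine {S : Set ℂ} {x b p q : ℂ} (hb : b ≠ 0)
    (h : JoinedIn S (x + b * p) (x + b * q)) : JoinedIn {z | x + b * z ∈ S} p q := by
  obtain ⟨γ, hγ⟩ := h
  have hx : ∀ z, (x + b * z - x) / b = z := fun z => by field_simp; ring
  refine ⟨(γ.map (f := fun z => (z - x) / b) (by fun_prop)).cast (hx p).symm (hx q).symm,
    fun t => ?_⟩
  have : x + b * ((γ t - x) / b) = γ t := by field_simp; ring
  simpa [this] using hγ t

open InnerProductSpace in
theorem false_of_fderiv_eq_zero {V : Set ℂ} (hV : IsCompact V) {H : ℂ → ℝ} (hH : Continuous H)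
    (hharm : HarmonicOnNhd H (interior V))
    (hpre : (frontier V ∩ {z | 0 < H z}).Nonempty → (frontier V ∩ {z | H z < 0}).Nonempty →
      IsPreconnected (frontier V ∩ {z | 0 < H z}) ∧ IsPreconnected (frontier V ∩ {z | H z < 0}))
    {x : ℂ} (hx : x ∈ interior V) (hx0 : H x = 0) (hd : fderiv ℝ H x = 0)
    (hne : ¬ ∀ᶠ y in 𝓝 x, H y = 0) : False := by
  obtain ⟨n, hn, b, hb, hrays⟩ := exists_alternating_rays (hharm x hx) hx0 hd hne
    (isOpen_interior.mem_nhds hx)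
  have hnR : (2 : ℝ) ≤ n := by exact_mod_cast hn
  have hn0 : (n : ℂ) ≠ 0 := by exact_mod_cast (by omega : n ≠ 0)
  set θ : ℝ := Real.pi / n with hθ
  have hθ0 : 0 < θ := div_pos Real.pi_pos (by linarith)
  have hθ1 : θ ≤ Real.pi / 2 := div_le_div_of_nonneg_left Real.pi_pos.le (by norm_num) hnR
  have hp₂ : Complex.exp ((2 * θ : ℝ) * Complex.I) ^ n = 1 := by
    rw [← Complex.exp_nat_mul, hθ, ← Complex.exp_two_pi_mul_I]
    congr 1
    push_cast
    field_simp
  have hq₁ : Complex.exp (θ * Complex.I) ^ n = -1 := by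
    rw [← Complex.exp_nat_mul, hθ, ← Complex.exp_pi_mul_I]
    congr 1
    push_cast
    field_simp
  have hq₂ : Complex.exp (-(θ * Complex.I)) ^ n = -1 := by
    rw [Complex.exp_neg, inv_pow, hq₁]
    norm_num
  have hpos := fun (s : ℝ) hs hs1 w (hw : w ^ n = 1) => (hrays s hs hs1 w).1 hw
  have hneg := fun (s : ℝ) hs hs1 w (hw : w ^ n = -1) => (hrays s hs hs1 w).2 hw
  have hnegharm : HarmonicOnNhd (-H) (interior V) := hharm.neg
  have hnegset : {z | 0 < (-H) z} = {z | H z < 0} := by ext z; simp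
  have p1 := hpos 1 one_pos le_rfl 1 (one_pow n)
  have p2 := hpos 1 one_pos le_rfl _ hp₂
  have q1 := hneg 1 one_pos le_rfl _ hq₁
  have q2 := hneg 1 one_pos le_rfl _ hq₂
  simp only [Complex.ofReal_one, one_mul] at p1 p2 q1 q2
  obtain ⟨hApos, hAneg⟩ := hpre
    (by
      obtain ⟨q, hq, hq'⟩ :=
        exists_mem_frontier_inter_connectedComponentIn_pos hV hH hharm p1.1 p1.2
      exact ⟨q, hq, connectedComponentIn_subset _ _ hq'⟩)
    (by
      obtain ⟨q, hq, hq'⟩ := exists_mem_frontier_inter_connectedComponentIn_pos hV hH.neg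
        hnegharm q1.1 (by simpa using q1.2)
      have := connectedComponentIn_subset _ _ hq'
      exact ⟨q, hq, by simpa using this⟩)
  have hP := joinedIn_setOf_pos hV hH hharm hApos p1.1 p1.2 p2.1 p2.2
  have hN := joinedIn_setOf_pos hV hH.neg hnegharm (hnegset ▸ hAneg) q1.1
    (by simpa using q1.2) q2.1 (by simpa using q2.2)
  rw [hnegset] at hN
  refine not_joinedIn_alternating_rays (P := {z | x + b * z ∈ {z | 0 < H z}})
    (N := {z | x + b * z ∈ {z | H z < 0}}) ?_ (by simp [hx0]) (by simp [hx0]) hθ0 hθ1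
    (fun s hs hs1 => (hpos s hs hs1 1 (one_pow n)).2) (fun s hs hs1 => (hpos s hs hs1 _ hp₂).2)
    (fun s hs hs1 => (hneg s hs hs1 _ hq₁).2) (fun s hs hs1 => (hneg s hs hs1 _ hq₂).2)
    (hP.of_affine hb) (hN.of_affine hb)
  exact Set.disjoint_left.2 fun z (h1 : 0 < H _) (h2 : H _ < 0) => lt_asymm h1 h2

section Convex

variable {E : Type*} [NormedAddCommGroup E] [NormedSpace ℝ E]

/-- The radial projection onto the boundary of a bounded convex set from an interior point. -/
theorem Convex.exists_radial_projection {W : Set E} (hW : Convex ℝ W)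
    (hb : Bornology.IsBounded W) {w₀ : E} (hw₀ : w₀ ∈ interior W) :
    ∃ g : E → ℝ, Continuous g ∧ (∀ x ≠ 0, 0 < g x) ∧
      (∀ x ≠ 0, w₀ + (g x)⁻¹ • x ∈ frontier W) ∧ ∀ p ∈ frontier W, g (p - w₀) = 1 := by
  set s : Set E := (Homeomorph.addLeft w₀) ⁻¹' W with hs
  have hs0 : s ∈ 𝓝 (0 : E) := by
    have : Tendsto (Homeomorph.addLeft w₀) (𝓝 0) (𝓝 w₀) := by
      simpa using (Homeomorph.addLeft w₀).continuous.tendsto 0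
    exact this (mem_interior_iff_mem_nhds.1 hw₀)
  have hsc : Convex ℝ s := hW.translate_preimage_right w₀
  have hsb : Bornology.IsBounded s := by
    have : s = (fun x => -w₀ + x) '' W := by
      ext x
      simp [hs]
    rw [this]
    exact (isometry_add_left (-w₀)).lipschitz.isBounded_image hb
  have hfr : frontier s = (Homeomorph.addLeft w₀) ⁻¹' frontier W :=
    ((Homeomorph.addLeft w₀).preimage_frontier W).symm
  have hpos : ∀ x : E, x ≠ 0 → 0 < gauge s x := fun x hx =>
    (gauge_pos (absorbent_nhds_zero hs0) ((NormedSpace.isVonNBounded_iff ℝ).2 hsb)).2 hx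
  refine ⟨gauge s, continuous_gauge hsc hs0, hpos, fun x hx => ?_, fun p hp => ?_⟩
  · have h1 : gauge s ((gauge s x)⁻¹ • x) = 1 := by
      rw [gauge_smul_of_nonneg (inv_nonneg.2 (gauge_nonneg x)), smul_eq_mul,
        inv_mul_cancel₀ (hpos x hx).ne']
    have h2 := (gauge_eq_one_iff_mem_frontier hsc hs0).1 h1
    rw [hfr] at h2
    exact h2
  · rw [gauge_eq_one_iff_mem_frontier hsc hs0, hfr]
    simpa using hp

theorem Convex.isPreconnected_frontier_inter_lt {W : Set E} (hW : Convex ℝ W)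
    (hb : Bornology.IsBounded W) {w₀ : E} (hw₀ : w₀ ∈ interior W) (l : E →L[ℝ] ℝ) :
    IsPreconnected (frontier W ∩ {p | l w₀ < l p}) := by
  obtain ⟨g, hg, hpos, hfr, hone⟩ := hW.exists_radial_projection hb hw₀
  have hne : ∀ x, 0 < l x → x ≠ 0 := by
    rintro x hx rfl
    simp at hx
  have himg : (fun x => w₀ + (g x)⁻¹ • x) '' {x | 0 < l x} =
      frontier W ∩ {p | l w₀ < l p} := by
    ext p
    constructor
    · rintro ⟨x, hx, rfl⟩
      refine ⟨hfr x (hne x hx), ?_⟩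
      have : 0 < (g x)⁻¹ * l x := mul_pos (inv_pos.2 (hpos x (hne x hx))) hx
      simpa using this
    · rintro ⟨hp, hlp⟩
      refine ⟨p - w₀, ?_, ?_⟩
      · simpa using hlp
      · simp [hone p hp]
  rw [← himg]
  have hconv : Convex ℝ {x | 0 < l x} := convex_halfSpace_gt l.toLinearMap.isLinear 0
  refine hconv.isPreconnected.image _ ?_
  refine continuousOn_const.add (ContinuousOn.smul ?_ continuousOn_id)
  exact hg.continuousOn.inv₀ fun x hx => (hpos x (hne x hx)).ne'

theorem Convex.exists_mem_frontier_ne {W : Set E} (hW : Convex ℝ W)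
    (hb : Bornology.IsBounded W) (hinterior : (interior W).Nonempty) {l : E →L[ℝ] ℝ} (hl : l ≠ 0)
    (c : ℝ) : ∃ p ∈ frontier W, l p ≠ c := by
  obtain ⟨w₀, hw₀⟩ := hinterior
  obtain ⟨g, hg, hpos, hfr, hone⟩ := hW.exists_radial_projection hb hw₀
  obtain ⟨e, he⟩ : ∃ e, l e ≠ 0 := by
    by_contra! h
    exact hl (ContinuousLinearMap.ext h)
  have he0 : e ≠ 0 := by
    rintro rfl
    simp at he
  by_contra! h
  have h1 := h _ (hfr e he0)
  have h2 := h _ (hfr (-e) (neg_ne_zero.2 he0))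
  simp only [map_add, map_smul, map_neg, smul_eq_mul] at h1 h2
  have hp1 := inv_pos.2 (hpos e he0)
  have hp2 := inv_pos.2 (hpos (-e) (neg_ne_zero.2 he0))
  have : ((g e)⁻¹ + (g (-e))⁻¹) * l e = 0 := by linarith
  rcases mul_eq_zero.1 this with h3 | h3
  · linarith
  · exact he h3

theorem Convex.exists_mem_interior_eq {W : Set E} (hW : Convex ℝ W)
    (hcl : W ⊆ closure (interior W)) (l : E →L[ℝ] ℝ) {c : ℝ} (h1 : ∃ p ∈ closure W, c < l p)
    (h2 : ∃ p ∈ closure W, l p < c) : ∃ w ∈ interior W, l w = c := by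
  have hcl' : closure W ⊆ closure (interior W) := closure_minimal hcl isClosed_closure
  obtain ⟨p, hp, hpc⟩ := h1
  obtain ⟨q, hq, hqc⟩ := h2
  obtain ⟨p', hp'c, hp'⟩ := mem_closure_iff.1 (hcl' hp) _ (isOpen_lt continuous_const l.continuous)
    hpc
  obtain ⟨q', hq'c, hq'⟩ := mem_closure_iff.1 (hcl' hq) _ (isOpen_lt l.continuous continuous_const)
    hqc
  exact hW.interior.isPreconnected.intermediate_value hq' hp' l.continuous.continuousOn
    ⟨le_of_lt hq'c, le_of_lt hp'c⟩

end Convex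

theorem IsCompact.isPreconnected_inter_preimage {X Y : Type*} [TopologicalSpace X]
    [TopologicalSpace Y] [T2Space Y] {J : Set X} (hJ : IsCompact J) {F : X → Y}
    (hF : ContinuousOn F J) (hinj : InjOn F J) {T : Set Y} (hT : IsPreconnected (F '' J ∩ T)) :
    IsPreconnected (J ∩ F ⁻¹' T) := by
  have : CompactSpace J := isCompact_iff_compactSpace.1 hJ
  have hcont : Continuous (fun x : J => F x) := continuousOn_iff_continuous_domRestrict.1 hF
  have hemb : Topology.IsClosedEmbedding (fun x : J => F x) :=
    hcont.isClosedEmbedding fun x y hxy => Subtype.ext (hinj x.2 y.2 hxy)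
  have himg : (fun x : J => F x) '' {x : J | F x ∈ T} = F '' J ∩ T := by
    ext y
    constructor
    · rintro ⟨x, hx, rfl⟩
      exact ⟨⟨x, x.2, rfl⟩, hx⟩
    · rintro ⟨⟨x, hx, rfl⟩, hy⟩
      exact ⟨⟨x, hx⟩, hy, rfl⟩
  have h1 : IsPreconnected {x : J | F x ∈ T} :=
    hemb.isInducing.isPreconnected_image.1 (himg ▸ hT)
  have himg' : ((↑) : J → X) '' {x : J | F x ∈ T} = J ∩ F ⁻¹' T := by
    ext x
    constructor
    · rintro ⟨x, hx, rfl⟩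
      exact ⟨x.2, hx⟩
    · rintro ⟨hx, hy⟩
      exact ⟨⟨x, hx⟩, hy, rfl⟩
  exact himg' ▸ h1.image _ continuous_subtype_val.continuousOn

open InnerProductSpace in
theorem HarmonicOn2.harmonicOnNhd_comp {u : ℝ × ℝ → ℝ} {Ω : Set (ℝ × ℝ)} (hΩ : IsOpen Ω)
    (h : HarmonicOn2 u Ω) :
    HarmonicOnNhd (fun z => u (Complex.equivRealProdCLM z)) (Complex.equivRealProdCLM ⁻¹' Ω) := by
  have hΩ' : IsOpen (Complex.equivRealProdCLM ⁻¹' Ω) :=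
    hΩ.preimage Complex.equivRealProdCLM.continuous
  have hC : ∀ z ∈ Complex.equivRealProdCLM ⁻¹' Ω,
      ContDiffAt ℝ 2 (fun z => u (Complex.equivRealProdCLM z)) z := fun z hz =>
    (h.1.contDiffAt (hΩ.mem_nhds hz)).comp z Complex.equivRealProdCLM.contDiff.contDiffAt
  have hD : ∀ z ∈ Complex.equivRealProdCLM ⁻¹' Ω, ∀ w,
      fderiv ℝ (fderiv ℝ (fun z => u (Complex.equivRealProdCLM z))) z w w =
        fderiv ℝ (fun q => fderiv ℝ u q (Complex.equivRealProdCLM w))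
          (Complex.equivRealProdCLM z) (Complex.equivRealProdCLM w) := by
    intro z hz w
    have hdiff : DifferentiableAt ℝ (fderiv ℝ (fun z => u (Complex.equivRealProdCLM z))) z :=
      ((hC z hz).fderiv_right (m := 1) (by norm_num)).differentiableAt (by norm_num)
    have h1 : fderiv ℝ (fun y => fderiv ℝ (fun z => u (Complex.equivRealProdCLM z)) y w) z w =
        fderiv ℝ (fderiv ℝ (fun z => u (Complex.equivRealProdCLM z))) z w w := by
      rw [fderiv_clm_apply hdiff (differentiableAt_const w)]
      simp
    rw [← h1]
    have h2 : (fun y => fderiv ℝ (fun z => u (Complex.equivRealProdCLM z)) y w) =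
        (fun q => fderiv ℝ u q (Complex.equivRealProdCLM w)) ∘ Complex.equivRealProdCLM := by
      ext y
      have := Complex.equivRealProdCLM.comp_right_fderiv (f := u) (x := y)
      exact congrArg (fun L => L w) this
    rw [h2, ContinuousLinearEquiv.comp_right_fderiv]
    rfl
  refine fun z hz => ⟨hC z hz, ?_⟩
  filter_upwards [hΩ'.mem_nhds hz] with y hy
  rw [laplacian_eq_iteratedFDeriv_complexPlane]
  simp only [iteratedFDeriv_two_apply, Matrix.cons_val_zero, Matrix.cons_val_one]
  rw [hD y hy, hD y hy]
  simpa [lap2] using h.2 _ hy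

theorem IsClosureOfSCRegion.isCompact {V : Set (ℝ × ℝ)} (h : IsClosureOfSCRegion V) :
    IsCompact V := by
  obtain ⟨Ω, -, hb, -, -, rfl⟩ := h
  exact hb.isCompact_closure

theorem IsClosureOfSCRegion.subset_closure_interior {V : Set (ℝ × ℝ)}
    (h : IsClosureOfSCRegion V) : V ⊆ closure (interior V) := by
  obtain ⟨Ω, ho, -, -, -, rfl⟩ := h
  exact closure_mono (interior_maximal subset_closure ho)

theorem IsClosureOfSCRegion.interior_nonempty {V : Set (ℝ × ℝ)}
    (h : IsClosureOfSCRegion V) : (interior V).Nonempty := by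
  obtain ⟨Ω, ho, -, hne, -, rfl⟩ := h
  exact hne.mono (interior_maximal subset_closure ho)

theorem IsClosureOfSCRegion.isPreconnected_interior {V : Set (ℝ × ℝ)}
    (h : IsClosureOfSCRegion V) : IsPreconnected (interior V) := by
  obtain ⟨Ω, ho, -, -, hsc, rfl⟩ := h
  have : IsPreconnected Ω := isPreconnected_iff_preconnectedSpace.2 inferInstance
  exact this.subset_closure (interior_maximal subset_closure ho) interior_subset

theorem OrientPresBoundaryHomeo.image_frontier {F : ℝ × ℝ → ℝ × ℝ} {V W : Set (ℝ × ℝ)}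
    (h : OrientPresBoundaryHomeo F V W) : F '' frontier V = frontier W := by
  obtain ⟨γ, h1, h2⟩ := h
  rw [← h1.2.2.2.1, ← h2.2.2.2.1, image_comp]

theorem OrientPresBoundaryHomeo.injOn_frontier {F : ℝ × ℝ → ℝ × ℝ} {V W : Set (ℝ × ℝ)}
    (h : OrientPresBoundaryHomeo F V W) : InjOn F (frontier V) := by
  obtain ⟨γ, h1, h2⟩ := h
  rw [← h1.2.2.2.1]
  rintro _ ⟨s, hs, rfl⟩ _ ⟨t, ht, rfl⟩ hst
  rw [h2.2.2.1 hs ht hst]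

open InnerProductSpace in
theorem smul_fderiv_add_smul_fderiv_ne_zero {V W : Set (ℝ × ℝ)}
    (hV : IsClosureOfSCRegion V) (hW : IsClosureOfSCRegion W) (hWconv : Convex ℝ W)
    {u v : ℝ × ℝ → ℝ} (hu : ContinuousOn u V) (hv : ContinuousOn v V)
    (huh : HarmonicOn2 u (interior V)) (hvh : HarmonicOn2 v (interior V))
    (hbd : OrientPresBoundaryHomeo (fun p => (u p, v p)) V W) {x : ℝ × ℝ}
    (hx : x ∈ interior V) {a b : ℝ} (hab : a ≠ 0 ∨ b ≠ 0) :
    a • fderiv ℝ u x + b • fderiv ℝ v x ≠ 0 := by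
  intro hzero
  set F : ℝ × ℝ → ℝ × ℝ := fun p => (u p, v p) with hF
  set l : ℝ × ℝ →L[ℝ] ℝ :=
    a • ContinuousLinearMap.fst ℝ ℝ ℝ + b • ContinuousLinearMap.snd ℝ ℝ ℝ with hl
  have hlF : ∀ p, l (F p) = a * u p + b * v p := fun p => by simp [hl, hF]
  have hl0 : l ≠ 0 := by
    intro h
    have h1 := congrArg (fun L : ℝ × ℝ →L[ℝ] ℝ => L (1, 0)) h
    have h2 := congrArg (fun L : ℝ × ℝ →L[ℝ] ℝ => L (0, 1)) h
    simp [hl] at h1 h2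
    tauto
  set c : ℝ := l (F x)
  set e := Complex.equivRealProdCLM
  have hVc : IsCompact (e ⁻¹' V) := e.toHomeomorph.isCompact_preimage.2 hV.isCompact
  have hinterior : e ⁻¹' interior V = interior (e ⁻¹' V) := e.toHomeomorph.preimage_interior V
  have hfr : e ⁻¹' frontier V = frontier (e ⁻¹' V) := e.toHomeomorph.preimage_frontier V
  have hcl : frontier V ⊆ V := hV.isCompact.isClosed.frontier_subset
  have hFc : ContinuousOn F V := hu.prodMk hv
  obtain ⟨H, hHV⟩ : ∃ H : C(ℂ, ℝ), ∀ z ∈ e ⁻¹' V, H z = l (F (e z)) - c := by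
    have hcont : ContinuousOn (fun z => l (F (e z)) - c) (e ⁻¹' V) :=
      (l.continuous.comp_continuousOn (hFc.comp e.continuous.continuousOn fun z hz => hz)).sub
        continuousOn_const
    obtain ⟨H, hH⟩ := ContinuousMap.exists_restrict_eq hVc.isClosed
      ⟨fun z : e ⁻¹' V => l (F (e z)) - c, continuousOn_iff_continuous_domRestrict.1 hcont⟩
    exact ⟨H, fun z hz => congrArg (fun f => f ⟨z, hz⟩) hH⟩
  have hev : ∀ z ∈ e ⁻¹' interior V,
      (H : ℂ → ℝ) =ᶠ[𝓝 z] (a • fun z => u (e z)) + (b • fun z => v (e z)) + fun _ => -c := by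
    intro z hz
    filter_upwards [(isOpen_interior.preimage e.continuous).mem_nhds hz] with y hy
    rw [hHV y (interior_subset (s := V) hy), hlF]
    simp [sub_eq_add_neg]
  have hharm : HarmonicOnNhd H (interior (e ⁻¹' V)) := by
    rw [← hinterior]
    intro z hz
    rw [harmonicAt_congr_nhds (hev z hz)]
    exact (((huh.harmonicOnNhd_comp isOpen_interior z hz).const_smul).add
      ((hvh.harmonicOnNhd_comp isOpen_interior z hz).const_smul)).add (harmonicAt_const _)
  have hHfr : ∀ z ∈ frontier (e ⁻¹' V), H z = l (F (e z)) - c := fun z hz =>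
    hHV z (hcl (hfr.superset hz))
  have hpos : frontier (e ⁻¹' V) ∩ {z | 0 < H z} =
      frontier (e ⁻¹' V) ∩ (F ∘ e) ⁻¹' {p | c < l p} := by
    ext z
    refine and_congr_right fun hz => ?_
    simp [hHfr z hz]
  have hneg : frontier (e ⁻¹' V) ∩ {z | H z < 0} =
      frontier (e ⁻¹' V) ∩ (F ∘ e) ⁻¹' {p | l p < c} := by
    ext z
    refine and_congr_right fun hz => ?_
    simp [hHfr z hz]
  have himg : (F ∘ e) '' frontier (e ⁻¹' V) = frontier W := by
    rw [image_comp, ← hfr, image_preimage_eq _ e.surjective, hbd.image_frontier]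
  have hinj : InjOn (F ∘ e) (frontier (e ⁻¹' V)) := by
    rw [← hfr]
    exact hbd.injOn_frontier.comp e.injective.injOn fun z hz => hz
  have hJ : IsCompact (frontier (e ⁻¹' V)) := hVc.of_isClosed_subset isClosed_frontier
    hVc.isClosed.frontier_subset
  have hFe : ContinuousOn (F ∘ e) (frontier (e ⁻¹' V)) :=
    hFc.comp e.continuous.continuousOn fun z hz => hVc.isClosed.frontier_subset hz
  have hex : e (e.symm x) = x := e.apply_symm_apply x
  refine false_of_fderiv_eq_zero hVc H.continuous hharm ?_ (x := e.symm x) ?_ ?_ ?_ ?_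
  · rintro ⟨p, hp⟩ ⟨q, hq⟩
    rw [hpos] at hp
    rw [hneg] at hq
    obtain ⟨w, hw, hwc⟩ := hWconv.exists_mem_interior_eq hW.subset_closure_interior l
      ⟨_, frontier_subset_closure (himg ▸ mem_image_of_mem _ hp.1), hp.2⟩
      ⟨_, frontier_subset_closure (himg ▸ mem_image_of_mem _ hq.1), hq.2⟩
    have hWb := hW.isCompact.isBounded
    have hp' := hWconv.isPreconnected_frontier_inter_lt hWb hw l
    have hq' := hWconv.isPreconnected_frontier_inter_lt hWb hw (-l)
    simp only [neg_apply, neg_lt_neg_iff] at hq'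
    rw [hwc, ← himg] at hp' hq'
    rw [hpos, hneg]
    exact ⟨hJ.isPreconnected_inter_preimage hFe hinj hp',
      hJ.isPreconnected_inter_preimage hFe hinj hq'⟩
  · rw [← hinterior]
    simpa using hx
  · rw [hHV _ (by simpa using interior_subset hx), hex, sub_self]
  · have hxe : e.symm x ∈ e ⁻¹' interior V := by simpa using hx
    have hdu : DifferentiableAt ℝ u x :=
      (huh.1.contDiffAt (isOpen_interior.mem_nhds hx)).differentiableAt (by norm_num)
    have hdv : DifferentiableAt ℝ v x :=
      (hvh.1.contDiffAt (isOpen_interior.mem_nhds hx)).differentiableAt (by norm_num)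
    have h1 : HasFDerivAt (a • u + b • v + fun _ => -c) (0 : ℝ × ℝ →L[ℝ] ℝ) (e (e.symm x)) := by
      rw [hex, ← hzero]
      exact ((hdu.hasFDerivAt.const_smul a).add (hdv.hasFDerivAt.const_smul b)).add_const _
    have h2 := (h1.comp _ e.hasFDerivAt).fderiv
    rw [(hev _ hxe).fderiv_eq, ContinuousLinearMap.zero_comp] at *
    exact h2
  · intro h0
    have hpc : IsPreconnected (interior (e ⁻¹' V)) := by
      rw [← hinterior]
      exact (e.toHomeomorph.isPreconnected_preimage).2 hV.isPreconnected_interior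
    have hxi : e.symm x ∈ interior (e ⁻¹' V) := by
      rw [← hinterior]
      simpa using hx
    have han : AnalyticOnNhd ℝ H (interior (e ⁻¹' V)) := fun z hz =>
      HarmonicAt.analyticAt (hharm z hz)
    have hEq := han.eqOn_zero_of_preconnected_of_eventuallyEq_zero hpc hxi h0
    have hVi : e ⁻¹' V ⊆ closure (interior (e ⁻¹' V)) := by
      rw [← hinterior]
      exact (preimage_mono hV.subset_closure_interior).trans
        (e.toHomeomorph.preimage_closure _).subset
    have hEq' := (hEq.closure H.continuous continuous_zero).mono hVi
    obtain ⟨p, hp, hpc⟩ := hWconv.exists_mem_frontier_ne hW.isCompact.isBounded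
      hW.interior_nonempty hl0 c
    rw [← himg] at hp
    obtain ⟨z, hz, rfl⟩ := hp
    have h3 := hEq' (hVc.isClosed.frontier_subset hz)
    rw [hHfr z hz] at h3
    exact hpc (sub_eq_zero.1 h3)

/-- Let `F = (u, v)` with `u, v` continuous on `V`, continuously
differentiable and harmonic on its interior, and `F|∂V` an orientation-preserving
homeomorphism onto `∂W` with `W` convex. Then the Jacobian determinant of `F` is nonzero at
every interior point of `V`; equivalently `∇u(x)` and `∇v(x)` are linearly independent. -/
theorem harmonic_map_jacobian_nonvanishing (V W : Set (ℝ × ℝ))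
    (hV : IsClosureOfSCRegion V) (hW : IsClosureOfSCRegion W) (hWconv : Convex ℝ W)
    (u v : ℝ × ℝ → ℝ)
    (hu : ContinuousOn u V) (hv : ContinuousOn v V)
    (hu1 : ContDiffOn ℝ 1 u (interior V)) (hv1 : ContDiffOn ℝ 1 v (interior V))
    (huh : HarmonicOn2 u (interior V)) (hvh : HarmonicOn2 v (interior V))
    (hbd : OrientPresBoundaryHomeo (fun p => (u p, v p)) V W) :
    ∀ x ∈ interior V, jacDet (fun p => (u p, v p)) x ≠ 0 ∧
      LinearIndependent ℝ ![fderiv ℝ u x, fderiv ℝ v x] := by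
  intro x hx
  have key : ∀ a b : ℝ, a • fderiv ℝ u x + b • fderiv ℝ v x = 0 → a = 0 ∧ b = 0 := by
    intro a b h
    by_contra hab
    exact smul_fderiv_add_smul_fderiv_ne_zero hV hW hWconv hu hv huh hvh hbd hx
      (by tauto) h
  have hdu : DifferentiableAt ℝ u x :=
    (hu1.contDiffAt (isOpen_interior.mem_nhds hx)).differentiableAt (by norm_num)
  have hdv : DifferentiableAt ℝ v x :=
    (hv1.contDiffAt (isOpen_interior.mem_nhds hx)).differentiableAt (by norm_num)
  refine ⟨fun hdet => ?_, LinearIndependent.pair_iff.2 key⟩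
  rw [jacDet, (hdu.hasFDerivAt.prodMk hdv.hasFDerivAt).fderiv] at hdet
  simp only [ContinuousLinearMap.prod_apply] at hdet
  have hker : ∀ a b : ℝ,
      a * fderiv ℝ u x (1, 0) + b * fderiv ℝ v x (1, 0) = 0 →
      a * fderiv ℝ u x (0, 1) + b * fderiv ℝ v x (0, 1) = 0 → a = 0 ∧ b = 0 := by
    intro a b h1 h2
    refine key a b ?_
    ext <;> simpa
  obtain ⟨h1, h2⟩ := hker (fderiv ℝ v x (1, 0)) (-fderiv ℝ u x (1, 0)) (by ring) (by linarith)
  obtain ⟨h3, h4⟩ := hker (fderiv ℝ v x (0, 1)) (-fderiv ℝ u x (0, 1)) (by linarith) (by ring)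
  rw [neg_eq_zero] at h2 h4
  exact one_ne_zero (hker 1 0 (by simp [h2]) (by simp [h4])).1
end
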